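/- arXiv:1208.2342 — 11 statements merged into one kernel-verified Lean document; each statement's English description precedes it below -/
import Mathlib

section
/- Let v₀, v₁ : Ω → ℝ be twice continuously differentiable and positive on Ω, set v := v₁/v₀ and W(x) := |∇v(x)|²_{A(x)}/(4 v(x)²). If P v₀ = 0 and P v₁ = 0 on Ω, then for every α ∈ [0,1] the function v_α := v₁^α · v₀^{1−α} satisfies P v_α = 4α(1−α) · W · v_α pointwise on Ω. If instead only P v₀ ≥ 0 and P v₁ ≥ 0 on Ω, then P v_α ≥ 4α(1−α) · W · v_α pointwise on Ω. -/
open MeasureTheory Finset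

noncomputable section

abbrev Euc (n : ℕ) := EuclideanSpace ℝ (Fin n)

/-- The `i`-th partial derivative of `u` at `x`. -/
def pd {n : ℕ} (i : Fin n) (u : Euc n → ℝ) (x : Euc n) : ℝ :=
  fderiv ℝ u x (EuclideanSpace.single i 1)

/-- The second partial derivative `∂ᵢ∂ⱼ u` at `x`. -/
def pd2 {n : ℕ} (i j : Fin n) (u : Euc n → ℝ) (x : Euc n) : ℝ :=
  fderiv ℝ (fun y => fderiv ℝ u y (EuclideanSpace.single j 1)) x
    (EuclideanSpace.single i 1)

/-- The quadratic form `|ξ|²_{A(x)} = ξ · (A(x) ξ)`. -/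
def quadA {n : ℕ} (A : Euc n → Matrix (Fin n) (Fin n) ℝ) (x : Euc n)
    (ξ : Fin n → ℝ) : ℝ :=
  ∑ i, ∑ j, ξ i * A x i j * ξ j

/-- The second-order elliptic operator
`(P u)(x) = −∑ᵢⱼ A(x)ᵢⱼ ∂ᵢ∂ⱼu(x) + b(x)·∇u(x) + c(x) u(x)`. -/
def ellOp {n : ℕ} (A : Euc n → Matrix (Fin n) (Fin n) ℝ)
    (b : Euc n → Fin n → ℝ) (c : Euc n → ℝ) (u : Euc n → ℝ) (x : Euc n) : ℝ :=
  -(∑ i, ∑ j, A x i j * pd2 i j u x) + (∑ i, b x i * pd i u x) + c x * u x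

section Derivatives

variable {n : ℕ} {α : ℝ} {v₀ v₁ : Euc n → ℝ} {x : Euc n}

theorem fderiv_div_apply_of_pos (h₀ : DifferentiableAt ℝ v₀ x) (h₁ : DifferentiableAt ℝ v₁ x)
    (hp : 0 < v₀ x) (e : Euc n) :
    fderiv ℝ (fun y => v₁ y / v₀ y) x e =
      (v₀ x * fderiv ℝ v₁ x e - v₁ x * fderiv ℝ v₀ x e) / v₀ x ^ 2 := by
  have hinv : HasFDerivAt (fun y => (v₀ y)⁻¹) (-(v₀ x ^ 2)⁻¹ • fderiv ℝ v₀ x) x :=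
    (hasDerivAt_inv hp.ne').comp_hasFDerivAt x h₀.hasFDerivAt
  simp only [div_eq_mul_inv (v₁ _)]
  rw [(h₁.hasFDerivAt.fun_mul hinv).fderiv]
  simp only [add_apply, smul_apply, smul_eq_mul]
  field_simp
  ring

theorem fderiv_rpow_mul_rpow_apply (h₀ : DifferentiableAt ℝ v₀ x) (h₁ : DifferentiableAt ℝ v₁ x)
    (hp₀ : 0 < v₀ x) (hp₁ : 0 < v₁ x) (e : Euc n) :
    fderiv ℝ (fun y => v₁ y ^ α * v₀ y ^ (1 - α)) x e =
      v₁ x ^ α * v₀ x ^ (1 - α) *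
        (α * (fderiv ℝ v₁ x e / v₁ x) + (1 - α) * (fderiv ℝ v₀ x e / v₀ x)) := by
  rw [((h₁.hasFDerivAt.rpow_const (p := α) (Or.inl hp₁.ne')).fun_mul
    (h₀.hasFDerivAt.rpow_const (p := 1 - α) (Or.inl hp₀.ne'))).fderiv]
  simp only [add_apply, smul_apply, smul_eq_mul,
    Real.rpow_sub_one hp₁.ne', Real.rpow_sub_one hp₀.ne']
  field_simp
  ring

theorem pd2_rpow_mul_rpow (h₀ : ContDiffAt ℝ 2 v₀ x) (h₁ : ContDiffAt ℝ 2 v₁ x)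
    (hp₀ : 0 < v₀ x) (hp₁ : 0 < v₁ x) (i j : Fin n) :
    pd2 i j (fun y => v₁ y ^ α * v₀ y ^ (1 - α)) x =
      v₁ x ^ α * v₀ x ^ (1 - α) *
        (α * (pd2 i j v₁ x / v₁ x) + (1 - α) * (pd2 i j v₀ x / v₀ x) -
          α * (1 - α) * ((pd i v₁ x / v₁ x - pd i v₀ x / v₀ x) *
            (pd j v₁ x / v₁ x - pd j v₀ x / v₀ x))) := by
  have d₀ : DifferentiableAt ℝ v₀ x := h₀.differentiableAt two_ne_zero
  have d₁ : DifferentiableAt ℝ v₁ x := h₁.differentiableAt two_ne_zero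
  have hfirst : (fun y => fderiv ℝ (fun y => v₁ y ^ α * v₀ y ^ (1 - α)) y
        (EuclideanSpace.single j 1)) =ᶠ[nhds x]
      fun y => v₁ y ^ α * v₀ y ^ (1 - α) *
        (α * (fderiv ℝ v₁ y (EuclideanSpace.single j 1) / v₁ y) +
          (1 - α) * (fderiv ℝ v₀ y (EuclideanSpace.single j 1) / v₀ y)) := by
    filter_upwards [h₀.eventually (by simp), h₁.eventually (by simp),
      continuousAt_const.eventually_lt d₀.continuousAt hp₀,
      continuousAt_const.eventually_lt d₁.continuousAt hp₁] with y hy₀ hy₁ hq₀ hq₁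
    exact fderiv_rpow_mul_rpow_apply (hy₀.differentiableAt two_ne_zero)
      (hy₁.differentiableAt two_ne_zero) hq₀ hq₁ _
  have hsecond : ∀ {v : Euc n → ℝ}, ContDiffAt ℝ 2 v x → DifferentiableAt ℝ
      (fun y => fderiv ℝ v y (EuclideanSpace.single j 1)) x := fun h =>
    ((h.fderiv_right (m := 1) (by norm_num)).differentiableAt one_ne_zero).clm_apply
      (differentiableAt_const _)
  have hdiv : ∀ {f g : Euc n → ℝ}, DifferentiableAt ℝ f x → DifferentiableAt ℝ g x → 0 < g x →
      DifferentiableAt ℝ (fun y => f y / g y) x := fun hf hg hp => by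
    simpa only [div_eq_mul_inv] using hf.fun_mul (hg.fun_inv hp.ne')
  have dw : DifferentiableAt ℝ (fun y => v₁ y ^ α * v₀ y ^ (1 - α)) x :=
    (d₁.rpow_const (Or.inl hp₁.ne')).fun_mul (d₀.rpow_const (Or.inl hp₀.ne'))
  have dq₀ := hdiv (hsecond h₀) d₀ hp₀
  have dq₁ := hdiv (hsecond h₁) d₁ hp₁
  rw [pd2, hfirst.fderiv_eq, fderiv_fun_mul dw ((dq₁.const_mul α).fun_add (dq₀.const_mul (1 - α))),
    fderiv_fun_add (dq₁.const_mul α) (dq₀.const_mul (1 - α)), fderiv_const_mul dq₁,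
    fderiv_const_mul dq₀]
  simp only [add_apply, smul_apply, smul_eq_mul]
  rw [fderiv_rpow_mul_rpow_apply d₀ d₁ hp₀ hp₁, fderiv_div_apply_of_pos d₀ (hsecond h₀) hp₀,
    fderiv_div_apply_of_pos d₁ (hsecond h₁) hp₁]
  simp only [pd, pd2]
  field_simp
  ring

theorem quadA_pd_div (A : Euc n → Matrix (Fin n) (Fin n) ℝ) (h₀ : DifferentiableAt ℝ v₀ x)
    (h₁ : DifferentiableAt ℝ v₁ x) (hp₀ : 0 < v₀ x) (hp₁ : 0 < v₁ x) :
    quadA A x (fun i => pd i (fun y => v₁ y / v₀ y) x) / (v₁ x / v₀ x) ^ 2 =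
      quadA A x (fun i => pd i v₁ x / v₁ x - pd i v₀ x / v₀ x) := by
  simp only [quadA, Finset.sum_div, pd, fderiv_div_apply_of_pos h₀ h₁ hp₀]
  refine Finset.sum_congr rfl fun i _ => Finset.sum_congr rfl fun j _ => ?_
  field_simp

theorem ellOp_rpow_mul_rpow (A : Euc n → Matrix (Fin n) (Fin n) ℝ) (b : Euc n → Fin n → ℝ)
    (c : Euc n → ℝ) (h₀ : ContDiffAt ℝ 2 v₀ x) (h₁ : ContDiffAt ℝ 2 v₁ x)
    (hp₀ : 0 < v₀ x) (hp₁ : 0 < v₁ x) :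
    ellOp A b c (fun y => v₁ y ^ α * v₀ y ^ (1 - α)) x =
      v₁ x ^ α * v₀ x ^ (1 - α) *
        (α * (ellOp A b c v₁ x / v₁ x) + (1 - α) * (ellOp A b c v₀ x / v₀ x) +
          α * (1 - α) * quadA A x (fun i => pd i v₁ x / v₁ x - pd i v₀ x / v₀ x)) := by
  have hpd (i : Fin n) : pd i (fun y => v₁ y ^ α * v₀ y ^ (1 - α)) x =
      v₁ x ^ α * v₀ x ^ (1 - α) * (α * (pd i v₁ x / v₁ x) + (1 - α) * (pd i v₀ x / v₀ x)) :=
    fderiv_rpow_mul_rpow_apply (h₀.differentiableAt two_ne_zero)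
      (h₁.differentiableAt two_ne_zero) hp₀ hp₁ _
  have hsecond : ∑ i, ∑ j, A x i j * pd2 i j (fun y => v₁ y ^ α * v₀ y ^ (1 - α)) x =
      v₁ x ^ α * v₀ x ^ (1 - α) * (α / v₁ x * (∑ i, ∑ j, A x i j * pd2 i j v₁ x) +
        (1 - α) / v₀ x * (∑ i, ∑ j, A x i j * pd2 i j v₀ x) -
        α * (1 - α) * quadA A x (fun i => pd i v₁ x / v₁ x - pd i v₀ x / v₀ x)) := by
    simp only [quadA, Finset.mul_sum, ← Finset.sum_add_distrib, ← Finset.sum_sub_distrib]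
    refine Finset.sum_congr rfl fun i _ => Finset.sum_congr rfl fun j _ => ?_
    rw [pd2_rpow_mul_rpow h₀ h₁ hp₀ hp₁]
    ring
  have hfirst : ∑ i, b x i * pd i (fun y => v₁ y ^ α * v₀ y ^ (1 - α)) x =
      v₁ x ^ α * v₀ x ^ (1 - α) * (α / v₁ x * (∑ i, b x i * pd i v₁ x) +
        (1 - α) / v₀ x * (∑ i, b x i * pd i v₀ x)) := by
    simp only [Finset.mul_sum, ← Finset.sum_add_distrib]
    refine Finset.sum_congr rfl fun i _ => ?_
    rw [hpd]
    ring
  simp only [ellOp]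
  rw [hsecond, hfirst]
  field_simp
  ring

end Derivatives

theorem stmt0 {n : ℕ} (hn : 1 ≤ n) {Ω : Set (Euc n)} (hΩ : IsOpen Ω)
    (A : Euc n → Matrix (Fin n) (Fin n) ℝ) (hAc : ContinuousOn A Ω)
    (hAs : ∀ x ∈ Ω, (A x).IsSymm) (hAp : ∀ x ∈ Ω, (A x).PosDef)
    (b : Euc n → Fin n → ℝ) (hb : ContinuousOn b Ω)
    (c : Euc n → ℝ) (hc : ContinuousOn c Ω)
    (v₀ v₁ : Euc n → ℝ)
    (hv₀ : ContDiffOn ℝ 2 v₀ Ω) (hv₁ : ContDiffOn ℝ 2 v₁ Ω)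
    (hv₀p : ∀ x ∈ Ω, 0 < v₀ x) (hv₁p : ∀ x ∈ Ω, 0 < v₁ x)
    (W : Euc n → ℝ)
    (hW : ∀ x ∈ Ω, W x =
      quadA A x (fun i => pd i (fun y => v₁ y / v₀ y) x) /
        (4 * (v₁ x / v₀ x) ^ 2)) :
    ((∀ x ∈ Ω, ellOp A b c v₀ x = 0) → (∀ x ∈ Ω, ellOp A b c v₁ x = 0) →
      ∀ α ∈ Set.Icc (0 : ℝ) 1, ∀ x ∈ Ω,
        ellOp A b c (fun y => v₁ y ^ α * v₀ y ^ (1 - α)) x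
          = 4 * α * (1 - α) * W x * (v₁ x ^ α * v₀ x ^ (1 - α))) ∧
    ((∀ x ∈ Ω, 0 ≤ ellOp A b c v₀ x) → (∀ x ∈ Ω, 0 ≤ ellOp A b c v₁ x) →
      ∀ α ∈ Set.Icc (0 : ℝ) 1, ∀ x ∈ Ω,
        4 * α * (1 - α) * W x * (v₁ x ^ α * v₀ x ^ (1 - α))
          ≤ ellOp A b c (fun y => v₁ y ^ α * v₀ y ^ (1 - α)) x) := by
  have key : ∀ α : ℝ, ∀ x ∈ Ω, ellOp A b c (fun y => v₁ y ^ α * v₀ y ^ (1 - α)) x =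
      4 * α * (1 - α) * W x * (v₁ x ^ α * v₀ x ^ (1 - α)) + v₁ x ^ α * v₀ x ^ (1 - α) *
        (α * (ellOp A b c v₁ x / v₁ x) + (1 - α) * (ellOp A b c v₀ x / v₀ x)) := by
    intro α x hx
    have h₀ := hv₀.contDiffAt (hΩ.mem_nhds hx)
    have h₁ := hv₁.contDiffAt (hΩ.mem_nhds hx)
    have hWx : 4 * W x = quadA A x (fun i => pd i v₁ x / v₁ x - pd i v₀ x / v₀ x) := by
      rw [hW x hx, ← quadA_pd_div A (h₀.differentiableAt two_ne_zero)
        (h₁.differentiableAt two_ne_zero) (hv₀p x hx) (hv₁p x hx), mul_comm (4 : ℝ) (_ ^ 2),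
        ← div_div, mul_div_cancel₀ _ four_ne_zero]
    rw [ellOp_rpow_mul_rpow A b c h₀ h₁ (hv₀p x hx) (hv₁p x hx), ← hWx]
    ring
  refine ⟨fun H₀ H₁ α _ x hx => ?_, fun H₀ H₁ α hα x hx => ?_⟩
  · simp [key α x hx, H₀ x hx, H₁ x hx]
  · have := hv₀p x hx
    have := hv₁p x hx
    have := H₀ x hx
    have := H₁ x hx
    have := hα.1
    have := sub_nonneg.2 hα.2
    rw [key α x hx]
    exact le_add_of_nonneg_right (by positivity)
end
end

section
/- Let v₀, v₁ : Ω → ℝ be twice continuously differentiable and positive on Ω with P v₀ = 0 and P v₁ = 0 on Ω, and set W(x) := ¼ |∇ log(v₁/v₀)(x)|²_{A(x)}. Then the function w := √(v₀ v₁) · log(v₀/v₁) satisfies P w = W · w pointwise on Ω. -/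
open MeasureTheory Finset

noncomputable section

section GeometricMeanLog

variable {E : Type*} [NormedAddCommGroup E] [NormedSpace ℝ E] {p q : E → ℝ} {p' q' : E →L[ℝ] ℝ}
  {x : E}

lemma hasFDerivAt_log_div (hp : HasFDerivAt p p' x) (hq : HasFDerivAt q q' x)
    (hp0 : 0 < p x) (hq0 : 0 < q x) :
    HasFDerivAt (fun y => Real.log (p y / q y)) ((p x)⁻¹ • p' - (q x)⁻¹ • q') x := by
  refine ((hp.log hp0.ne').sub (hq.log hq0.ne')).congr_of_eventuallyEq ?_
  filter_upwards [hp.continuousAt.eventually_ne hp0.ne',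
    hq.continuousAt.eventually_ne hq0.ne'] with y hy hy'
  simp [Real.log_div hy hy']

lemma hasFDerivAt_sqrt_mul (hp : HasFDerivAt p p' x) (hq : HasFDerivAt q q' x)
    (hp0 : 0 < p x) (hq0 : 0 < q x) :
    HasFDerivAt (fun y => √(p y * q y))
      ((√(p x * q x) / 2) • ((p x)⁻¹ • p' + (q x)⁻¹ • q')) x := by
  have hpq : 0 < p x * q x := mul_pos hp0 hq0
  refine ((hp.mul hq).sqrt hpq.ne').congr_fderiv ?_
  ext e
  have hs : √(p x * q x) ≠ 0 := (Real.sqrt_pos.2 hpq).ne'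
  have hsq : √(p x * q x) ^ 2 = p x * q x := Real.sq_sqrt hpq.le
  simp only [smul_apply, add_apply, smul_eq_mul,
    Pi.mul_apply]
  field_simp
  rw [hsq]
  ring

lemma hasFDerivAt_sqrt_mul_log_div (hp : HasFDerivAt p p' x) (hq : HasFDerivAt q q' x)
    (hp0 : 0 < p x) (hq0 : 0 < q x) :
    HasFDerivAt (fun y => √(p y * q y) * Real.log (p y / q y))
      ((√(p x * q x) * (Real.log (p x / q x) / 2 + 1) * (p x)⁻¹) • p' +
        (√(p x * q x) * (Real.log (p x / q x) / 2 - 1) * (q x)⁻¹) • q') x := by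
  refine ((hasFDerivAt_sqrt_mul hp hq hp0 hq0).mul
    (hasFDerivAt_log_div hp hq hp0 hq0)).congr_fderiv ?_
  ext e
  simp only [smul_apply, add_apply, smul_eq_mul,
    sub_apply]
  ring

/-- The derivatives of the coefficients of `dp` (take `σ = 1`, `f = p`) and of `dq` (take `σ = -1`,
`f = q`) in `d (√(pq) log (p/q))`. -/
lemma hasFDerivAt_sqrt_mul_log_div_coeff (hp : HasFDerivAt p p' x) (hq : HasFDerivAt q q' x)
    (hp0 : 0 < p x) (hq0 : 0 < q x) {f : E → ℝ} {f' : E →L[ℝ] ℝ} {σ : ℝ}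
    (hf : HasFDerivAt f f' x) (hf0 : f x ≠ 0) (hσ : σ ^ 2 = 1)
    (hff' : (f x)⁻¹ • f' = (1 / 2 : ℝ) • (((p x)⁻¹ • p' + (q x)⁻¹ • q') +
      σ • ((p x)⁻¹ • p' - (q x)⁻¹ • q'))) :
    HasFDerivAt (fun y => √(p y * q y) * (Real.log (p y / q y) / 2 + σ) * (f y)⁻¹)
      ((-σ * (√(p x * q x) * Real.log (p x / q x)) / 4 * (f x)⁻¹) •
        ((p x)⁻¹ • p' - (q x)⁻¹ • q')) x := by
  have hinv : HasFDerivAt (fun y => (f y)⁻¹) (-((f x)⁻¹ ^ 2 • f')) x := by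
    simpa [Function.comp_def] using (hasDerivAt_inv hf0).comp_hasFDerivAt x hf
  have hlog : HasFDerivAt (fun y => Real.log (p y / q y) / 2 + σ)
      ((1 / 2 : ℝ) • ((p x)⁻¹ • p' - (q x)⁻¹ • q')) x := by
    refine (((hasFDerivAt_log_div hp hq hp0 hq0).const_mul (1 / 2 : ℝ)).add_const
      σ).congr_of_eventuallyEq (.of_forall fun y => ?_)
    simp only []
    ring
  refine (((hasFDerivAt_sqrt_mul hp hq hp0 hq0).mul hlog).mul hinv).congr_fderiv ?_
  ext e
  have h := congrArg (fun l : E →L[ℝ] ℝ => l e) hff'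
  simp only [smul_apply, add_apply, smul_eq_mul,
    sub_apply, neg_apply, Pi.mul_apply] at h ⊢
  linear_combination (-(√(p x * q x) * (Real.log (p x / q x) / 2 + σ) * (f x)⁻¹)) * h -
    (√(p x * q x) * (f x)⁻¹ / 2) * ((p x)⁻¹ * p' e - (q x)⁻¹ * q' e) * hσ

end GeometricMeanLog

section PartialDerivatives

variable {n : ℕ} {Ω : Set (Euc n)} {p q : Euc n → ℝ} {x : Euc n}

lemma pd_log_div (hp : DifferentiableAt ℝ p x) (hq : DifferentiableAt ℝ q x)
    (hp0 : 0 < p x) (hq0 : 0 < q x) (i : Fin n) :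
    pd i (fun y => Real.log (p y / q y)) x = (p x)⁻¹ * pd i p x - (q x)⁻¹ * pd i q x := by
  simp [pd, (hasFDerivAt_log_div hp.hasFDerivAt hq.hasFDerivAt hp0 hq0).fderiv]

lemma pd_sqrt_mul_log_div (hp : DifferentiableAt ℝ p x) (hq : DifferentiableAt ℝ q x)
    (hp0 : 0 < p x) (hq0 : 0 < q x) (i : Fin n) :
    pd i (fun y => √(p y * q y) * Real.log (p y / q y)) x =
      √(p x * q x) * (Real.log (p x / q x) / 2 + 1) * (p x)⁻¹ * pd i p x +
        √(p x * q x) * (Real.log (p x / q x) / 2 - 1) * (q x)⁻¹ * pd i q x := by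
  simp [pd, (hasFDerivAt_sqrt_mul_log_div hp.hasFDerivAt hq.hasFDerivAt hp0 hq0).fderiv]

lemma differentiableAt_pd (hΩ : IsOpen Ω) (hp : ContDiffOn ℝ 2 p Ω) (hx : x ∈ Ω) (i : Fin n) :
    DifferentiableAt ℝ (pd i p) x := by
  have h : DifferentiableAt ℝ (fderiv ℝ p) x :=
    ((hp.fderiv_of_isOpen hΩ (m := 1) (by norm_num)).differentiableOn
      (by norm_num)).differentiableAt (hΩ.mem_nhds hx)
  exact h.clm_apply (differentiableAt_const _)

lemma pd2_sqrt_mul_log_div (hΩ : IsOpen Ω) (hp : ContDiffOn ℝ 2 p Ω) (hq : ContDiffOn ℝ 2 q Ω)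
    (hp0 : ∀ y ∈ Ω, 0 < p y) (hq0 : ∀ y ∈ Ω, 0 < q y) (hx : x ∈ Ω) (i j : Fin n) :
    pd2 i j (fun y => √(p y * q y) * Real.log (p y / q y)) x =
      √(p x * q x) * (Real.log (p x / q x) / 2 + 1) * (p x)⁻¹ * pd2 i j p x +
        √(p x * q x) * (Real.log (p x / q x) / 2 - 1) * (q x)⁻¹ * pd2 i j q x -
        √(p x * q x) * Real.log (p x / q x) / 4 *
          ((p x)⁻¹ * pd i p x - (q x)⁻¹ * pd i q x) *
          ((p x)⁻¹ * pd j p x - (q x)⁻¹ * pd j q x) := by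
  have dp : ∀ y ∈ Ω, DifferentiableAt ℝ p y := fun y hy =>
    (hp.differentiableOn (by norm_num)).differentiableAt (hΩ.mem_nhds hy)
  have dq : ∀ y ∈ Ω, DifferentiableAt ℝ q y := fun y hy =>
    (hq.differentiableOn (by norm_num)).differentiableAt (hΩ.mem_nhds hy)
  have hpx := (dp x hx).hasFDerivAt
  have hqx := (dq x hx).hasFDerivAt
  have hα := hasFDerivAt_sqrt_mul_log_div_coeff hpx hqx (hp0 x hx) (hq0 x hx) (σ := 1) hpx
    (hp0 x hx).ne' (by norm_num) (by module)
  have hβ := hasFDerivAt_sqrt_mul_log_div_coeff hpx hqx (hp0 x hx) (hq0 x hx) (σ := -1) hqx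
    (hq0 x hx).ne' (by norm_num) (by module)
  have key := ((hα.mul (differentiableAt_pd hΩ hp hx j).hasFDerivAt).add
    (hβ.mul (differentiableAt_pd hΩ hq hx j).hasFDerivAt)).congr_of_eventuallyEq
    (f₁ := pd j (fun y => √(p y * q y) * Real.log (p y / q y))) (by
      filter_upwards [hΩ.mem_nhds hx] with y hy
      rw [pd_sqrt_mul_log_div (dp y hy) (dq y hy) (hp0 y hy) (hq0 y hy)]
      simp [sub_eq_add_neg])
  change fderiv ℝ (pd j _) x _ = _
  rw [key.fderiv]
  change _ = _ * fderiv ℝ (pd j p) x _ + _ * fderiv ℝ (pd j q) x _ - _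
  simp only [smul_apply, add_apply, smul_eq_mul,
    sub_apply]
  simp only [pd]
  ring

end PartialDerivatives

theorem stmt1 {n : ℕ} (hn : 1 ≤ n) {Ω : Set (Euc n)} (hΩ : IsOpen Ω)
    (A : Euc n → Matrix (Fin n) (Fin n) ℝ) (hAc : ContinuousOn A Ω)
    (hAs : ∀ x ∈ Ω, (A x).IsSymm) (hAp : ∀ x ∈ Ω, (A x).PosDef)
    (b : Euc n → Fin n → ℝ) (hb : ContinuousOn b Ω)
    (c : Euc n → ℝ) (hc : ContinuousOn c Ω)
    (v₀ v₁ : Euc n → ℝ)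
    (hv₀ : ContDiffOn ℝ 2 v₀ Ω) (hv₁ : ContDiffOn ℝ 2 v₁ Ω)
    (hv₀p : ∀ x ∈ Ω, 0 < v₀ x) (hv₁p : ∀ x ∈ Ω, 0 < v₁ x)
    (hPv₀ : ∀ x ∈ Ω, ellOp A b c v₀ x = 0)
    (hPv₁ : ∀ x ∈ Ω, ellOp A b c v₁ x = 0)
    (W : Euc n → ℝ)
    (hW : ∀ x ∈ Ω, W x =
      (1 / 4) * quadA A x (fun i => pd i (fun y => Real.log (v₁ y / v₀ y)) x)) :
    ∀ x ∈ Ω,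
      ellOp A b c (fun y => Real.sqrt (v₀ y * v₁ y) * Real.log (v₀ y / v₁ y)) x
        = W x * (Real.sqrt (v₀ x * v₁ x) * Real.log (v₀ x / v₁ x)) := by
  intro x hx
  have d₀ : DifferentiableAt ℝ v₀ x :=
    (hv₀.differentiableOn (by norm_num)).differentiableAt (hΩ.mem_nhds hx)
  have d₁ : DifferentiableAt ℝ v₁ x :=
    (hv₁.differentiableOn (by norm_num)).differentiableAt (hΩ.mem_nhds hx)
  have p₀ := hv₀p x hx
  have p₁ := hv₁p x hx
  have e₀ := hPv₀ x hx
  have e₁ := hPv₁ x hx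
  rw [hW x hx]
  simp only [ellOp, quadA, pd_log_div d₁ d₀ p₁ p₀, pd_sqrt_mul_log_div d₀ d₁ p₀ p₁,
    pd2_sqrt_mul_log_div hΩ hv₀ hv₁ hv₀p hv₁p hx] at e₀ e₁ ⊢
  set S := √(v₀ x * v₁ x)
  set L := Real.log (v₀ x / v₁ x)
  set α := S * (L / 2 + 1) * (v₀ x)⁻¹ with hα
  set β := S * (L / 2 - 1) * (v₁ x)⁻¹ with hβ
  have first_order : ∑ i, b x i * (α * pd i v₀ x + β * pd i v₁ x) =
      α * ∑ i, b x i * pd i v₀ x + β * ∑ i, b x i * pd i v₁ x := by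
    simp only [mul_sum, ← sum_add_distrib]
    exact sum_congr rfl fun i _ => by ring
  have second_order : ∑ i, ∑ j, A x i j * (α * pd2 i j v₀ x + β * pd2 i j v₁ x -
        S * L / 4 * ((v₀ x)⁻¹ * pd i v₀ x - (v₁ x)⁻¹ * pd i v₁ x) *
          ((v₀ x)⁻¹ * pd j v₀ x - (v₁ x)⁻¹ * pd j v₁ x)) =
      α * ∑ i, ∑ j, A x i j * pd2 i j v₀ x + β * ∑ i, ∑ j, A x i j * pd2 i j v₁ x -
        S * L / 4 * ∑ i, ∑ j, ((v₁ x)⁻¹ * pd i v₁ x - (v₀ x)⁻¹ * pd i v₀ x) * A x i j *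
          ((v₁ x)⁻¹ * pd j v₁ x - (v₀ x)⁻¹ * pd j v₀ x) := by
    simp only [mul_sum, ← sum_add_distrib, ← sum_sub_distrib]
    exact sum_congr rfl fun i _ => sum_congr rfl fun j _ => by ring
  have euler : α * v₀ x + β * v₁ x = S * L := by
    rw [hα, hβ]
    field_simp
    ring
  rw [first_order, second_order]
  linear_combination α * e₀ + β * e₁ - c x * euler
end
end

section
/- Let N ≥ 1, let u₁, …, u_N : Ω → ℝ be twice continuously differentiable and positive on Ω, and let α₁, …, α_N be nonnegative real numbers with ∑_{j=1}^N α_j = 1. Set u := ∏_{j=1}^N u_j^{α_j} and W(x) := ∑_{1 ≤ i < j ≤ N} α_i α_j |∇ log(u_i/u_j)(x)|²_{A(x)}. Then P u = (∑_{j=1}^N α_j (P u_j)/u_j) · u + W · u pointwise on Ω. In particular, if P u_j = 0 on Ω for every j, then u satisfies P u = W · u on Ω, and if P u_j ≥ 0 on Ω for every j, then P u ≥ W · u on Ω. -/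
open MeasureTheory Finset

noncomputable section

theorem ContDiffAt.differentiableAt_pd {n : ℕ} {f : Euc n → ℝ} {x : Euc n}
    (hf : ContDiffAt ℝ 2 f x) (j : Fin n) : DifferentiableAt ℝ (pd j f) x :=
  ((hf.fderiv_right (m := 1) (by norm_num)).differentiableAt one_ne_zero).clm_apply
    (differentiableAt_const _)

theorem Filter.EventuallyEq.pd {n : ℕ} {f g : Euc n → ℝ} {x : Euc n}
    (h : f =ᶠ[nhds x] g) (i : Fin n) : _root_.pd i f =ᶠ[nhds x] _root_.pd i g :=
  h.fderiv.mono fun _ hy => congrArg (fun φ : Euc n →L[ℝ] ℝ => φ _) hy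

theorem pd_exp {n : ℕ} {f : Euc n → ℝ} {x : Euc n} (hf : DifferentiableAt ℝ f x)
    (i : Fin n) : pd i (fun y => Real.exp (f y)) x = Real.exp (f x) * pd i f x := by
  simp [pd, fderiv_exp hf]

theorem pd2_exp {n : ℕ} {f : Euc n → ℝ} {x : Euc n} (hf : ContDiffAt ℝ 2 f x)
    (i j : Fin n) :
    pd2 i j (fun y => Real.exp (f y)) x
      = Real.exp (f x) * (pd2 i j f x + pd i f x * pd j f x) := by
  have hev : pd j (fun y => Real.exp (f y)) =ᶠ[nhds x] fun y => Real.exp (f y) * pd j f y := by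
    filter_upwards [hf.eventually (by simp)] with y hy
    exact pd_exp (hy.differentiableAt two_ne_zero) j
  have hd := hf.differentiableAt two_ne_zero
  change pd i (pd j fun y => Real.exp (f y)) x = _
  rw [(hev.pd i).eq_of_nhds]
  change _ = Real.exp (f x) * (pd i (pd j f) x + pd i f x * pd j f x)
  rw [pd, fderiv_fun_mul hd.exp (hf.differentiableAt_pd j), fderiv_exp hd]
  simp only [pd, add_apply, smul_apply, smul_eq_mul]
  ring

theorem pd_sum_mul {n : ℕ} {ι : Type*} [Fintype ι] {f : ι → Euc n → ℝ} {x : Euc n}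
    (hf : ∀ k, DifferentiableAt ℝ (f k) x) (α : ι → ℝ) (i : Fin n) :
    pd i (fun y => ∑ k, α k * f k y) x = ∑ k, α k * pd i (f k) x := by
  simp only [pd]
  rw [fderiv_fun_sum fun k _ => (hf k).const_mul (α k)]
  simp [fderiv_const_mul (hf _)]

theorem pd2_sum_mul {n : ℕ} {ι : Type*} [Fintype ι] {f : ι → Euc n → ℝ} {x : Euc n}
    (hf : ∀ k, ContDiffAt ℝ 2 (f k) x) (α : ι → ℝ) (i j : Fin n) :
    pd2 i j (fun y => ∑ k, α k * f k y) x = ∑ k, α k * pd2 i j (f k) x := by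
  have hev : pd j (fun y => ∑ k, α k * f k y) =ᶠ[nhds x] fun y => ∑ k, α k * pd j (f k) y := by
    filter_upwards [Filter.eventually_all.2 fun k => (hf k).eventually (by simp)] with y hy
    exact pd_sum_mul (fun k => (hy k).differentiableAt two_ne_zero) α j
  exact ((hev.pd i).eq_of_nhds).trans (pd_sum_mul (fun k => (hf k).differentiableAt_pd j) α i)

theorem Filter.EventuallyEq.ellOp_eq {n : ℕ} {v w : Euc n → ℝ} {x : Euc n}
    (h : v =ᶠ[nhds x] w) (A : Euc n → Matrix (Fin n) (Fin n) ℝ) (b : Euc n → Fin n → ℝ)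
    (c : Euc n → ℝ) : ellOp A b c v x = ellOp A b c w x := by
  have h₁ : ∀ i, _root_.pd i v x = _root_.pd i w x := fun i => (h.pd i).eq_of_nhds
  have h₂ : ∀ i j, pd2 i j v x = pd2 i j w x := fun i j => ((h.pd j).pd i).eq_of_nhds
  simp only [ellOp, h₁, h₂, h.eq_of_nhds]

theorem ellOp_exp {n : ℕ} (A : Euc n → Matrix (Fin n) (Fin n) ℝ) (b : Euc n → Fin n → ℝ)
    (c : Euc n → ℝ) {f : Euc n → ℝ} {x : Euc n} (hf : ContDiffAt ℝ 2 f x) :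
    ellOp A b c (fun y => Real.exp (f y)) x
      = Real.exp (f x) * (ellOp A b 0 f x - quadA A x (fun k => pd k f x) + c x) := by
  simp only [ellOp, quadA, pd2_exp hf, pd_exp (hf.differentiableAt two_ne_zero), mul_add,
    mul_sub, mul_neg, Finset.mul_sum, Finset.sum_add_distrib, Pi.zero_apply, zero_mul, mul_zero]
  have h₁ : ∀ i j, A x i j * (Real.exp (f x) * pd2 i j f x)
      = Real.exp (f x) * (A x i j * pd2 i j f x) := fun i j => by ring
  have h₂ : ∀ i j, A x i j * (Real.exp (f x) * (pd i f x * pd j f x))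
      = Real.exp (f x) * (pd i f x * A x i j * pd j f x) := fun i j => by ring
  have h₃ : ∀ i, b x i * (Real.exp (f x) * pd i f x)
      = Real.exp (f x) * (b x i * pd i f x) := fun i => by ring
  simp only [h₁, h₂, h₃]
  ring

theorem ellOp_sum_mul {n : ℕ} {ι : Type*} [Fintype ι]
    (A : Euc n → Matrix (Fin n) (Fin n) ℝ) (b : Euc n → Fin n → ℝ)
    (c : Euc n → ℝ) {f : ι → Euc n → ℝ} {x : Euc n}
    (hf : ∀ k, ContDiffAt ℝ 2 (f k) x) (α : ι → ℝ) :
    ellOp A b c (fun y => ∑ k, α k * f k y) x = ∑ k, α k * ellOp A b c (f k) x := by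
  simp only [ellOp, pd2_sum_mul hf,
    pd_sum_mul fun k => (hf k).differentiableAt two_ne_zero, mul_add, mul_neg,
    Finset.mul_sum, Finset.sum_add_distrib, Finset.sum_neg_distrib]
  congr 1
  · congr 1
    · congr 1
      refine (Finset.sum_congr rfl fun i _ => Finset.sum_comm).trans ?_
      rw [Finset.sum_comm]
      simp only [mul_left_comm]
    · rw [Finset.sum_comm]
      simp only [mul_left_comm]
  · simp only [mul_left_comm]

theorem sum_sum_filter_lt_eq_half {ι : Type*} [Fintype ι] [LinearOrder ι] {F : ι → ι → ℝ}
    (hF : ∀ i j, F i j = F j i) (hF₀ : ∀ i, F i i = 0) :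
    ∑ i, ∑ j ∈ Finset.univ.filter (fun j => i < j), F i j = (∑ i, ∑ j, F i j) / 2 := by
  have hsplit : ∀ i j, F i j = (if i < j then F i j else 0) + (if j < i then F j i else 0) := by
    intro i j
    rcases lt_trichotomy i j with h | rfl | h
    · simp [h, h.not_gt]
    · simp [hF₀]
    · simp [h, h.not_gt, hF i j]
  have hsum : ∑ i, ∑ j, F i j = ∑ i, ∑ j, ((if i < j then F i j else 0)
      + (if j < i then F j i else 0)) :=
    Finset.sum_congr rfl fun i _ => Finset.sum_congr rfl fun j _ => hsplit i j
  simp only [Finset.sum_add_distrib] at hsum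
  rw [Finset.sum_comm (f := fun i j => if j < i then F j i else 0)] at hsum
  simp only [Finset.sum_filter]
  linarith

theorem sum_sum_weight_mul_sub_mul_sub {ι : Type*} [Fintype ι] {α : ι → ℝ}
    (hα : ∑ i, α i = 1) (a d : ι → ℝ) :
    (∑ i, ∑ j, α i * α j * ((a i - a j) * (d i - d j))) / 2
      = ∑ i, α i * (a i * d i) - (∑ i, α i * a i) * ∑ i, α i * d i := by
  have hexp : ∀ i j, α i * α j * ((a i - a j) * (d i - d j))
      = (α i * (a i * d i)) * α j + α i * (α j * (a j * d j))
        - (α i * a i) * (α j * d j) - (α i * d i) * (α j * a j) := fun i j => by ring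
  simp only [hexp, Finset.sum_add_distrib, Finset.sum_sub_distrib, ← Finset.mul_sum,
    ← Finset.sum_mul, hα]
  ring

theorem quadA_eq_sum_prod {n : ℕ} (A : Euc n → Matrix (Fin n) (Fin n) ℝ) (x : Euc n)
    (ξ : Fin n → ℝ) : quadA A x ξ = ∑ p : Fin n × Fin n, A x p.1 p.2 * (ξ p.1 * ξ p.2) := by
  rw [quadA, Fintype.sum_prod_type]
  exact Finset.sum_congr rfl fun i _ => Finset.sum_congr rfl fun j _ => by ring

theorem sum_filter_lt_quadA_sub {n : ℕ} {ι : Type*} [Fintype ι] [LinearOrder ι]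
    (A : Euc n → Matrix (Fin n) (Fin n) ℝ) (x : Euc n) {α : ι → ℝ} (hα : ∑ i, α i = 1)
    (g : ι → Fin n → ℝ) :
    ∑ i, ∑ j ∈ Finset.univ.filter (fun j => i < j),
        α i * α j * quadA A x (fun k => g i k - g j k)
      = ∑ i, α i * quadA A x (g i) - quadA A x (fun k => ∑ i, α i * g i k) := by
  rw [sum_sum_filter_lt_eq_half]
  · simp only [quadA_eq_sum_prod, Finset.mul_sum]
    have hcomm : ∑ i, ∑ j, ∑ p : Fin n × Fin n,
        α i * α j * (A x p.1 p.2 * ((g i p.1 - g j p.1) * (g i p.2 - g j p.2)))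
        = ∑ p : Fin n × Fin n, A x p.1 p.2 *
          ∑ i, ∑ j, α i * α j * ((g i p.1 - g j p.1) * (g i p.2 - g j p.2)) := by
      simp only [Finset.mul_sum]
      refine (Finset.sum_congr rfl fun i _ => Finset.sum_comm).trans ?_
      rw [Finset.sum_comm]
      simp only [mul_left_comm]
    have hcov : ∀ p : Fin n × Fin n,
        ∑ i, ∑ j, α i * α j * ((g i p.1 - g j p.1) * (g i p.2 - g j p.2))
          = 2 * (∑ i, α i * (g i p.1 * g i p.2)
            - (∑ i, α i * g i p.1) * ∑ i, α i * g i p.2) := fun p => by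
      rw [← sum_sum_weight_mul_sub_mul_sub hα (fun i => g i p.1) (fun i => g i p.2)]
      ring
    have hdiag : ∑ i, ∑ p : Fin n × Fin n, α i * (A x p.1 p.2 * (g i p.1 * g i p.2))
        = ∑ p : Fin n × Fin n, A x p.1 p.2 * ∑ i, α i * (g i p.1 * g i p.2) := by
      rw [Finset.sum_comm]
      simp only [Finset.mul_sum, mul_left_comm]
    simp only [← Finset.mul_sum] at hcomm hdiag ⊢
    rw [hcomm, hdiag, ← Finset.sum_sub_distrib, Finset.sum_div]
    refine Finset.sum_congr rfl fun p _ => ?_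
    rw [hcov]
    ring
  · intro i j
    simp only [quadA]
    rw [mul_comm (α i)]
    congr 1
    exact Finset.sum_congr rfl fun k _ => Finset.sum_congr rfl fun l _ => by ring
  · intro i
    simp [quadA]

theorem ellOp_prod_rpow {n : ℕ} {ι : Type*} [Fintype ι] [LinearOrder ι]
    (A : Euc n → Matrix (Fin n) (Fin n) ℝ) (b : Euc n → Fin n → ℝ) (c : Euc n → ℝ)
    {u : ι → Euc n → ℝ} {x : Euc n} (hu : ∀ j, ContDiffAt ℝ 2 (u j) x)
    (hup : ∀ j, 0 < u j x) {α : ι → ℝ} (hα : ∑ j, α j = 1) :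
    ellOp A b c (fun y => ∏ j, u j y ^ α j) x
      = (∑ j, α j * ellOp A b c (u j) x / u j x) * (∏ j, u j x ^ α j)
        + (∑ i, ∑ j ∈ Finset.univ.filter (fun j => i < j),
            α i * α j * quadA A x (fun k => pd k (fun y => Real.log (u i y / u j y)) x))
          * (∏ j, u j x ^ α j) := by
  have hpos : ∀ᶠ y in nhds x, ∀ j, 0 < u j y :=
    Filter.eventually_all.2 fun j => (hu j).continuousAt.eventually (lt_mem_nhds (hup j))
  set L : ι → Euc n → ℝ := fun j y => Real.log (u j y) with hL
  have hLc : ∀ j, ContDiffAt ℝ 2 (L j) x := fun j => (hu j).log (hup j).ne'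
  have hLd : ∀ j, DifferentiableAt ℝ (L j) x := fun j => (hLc j).differentiableAt two_ne_zero
  have hprod : (fun y => ∏ j, u j y ^ α j) =ᶠ[nhds x]
      fun y => Real.exp (∑ j, α j * L j y) := by
    filter_upwards [hpos] with y hy
    rw [Real.exp_sum]
    exact Finset.prod_congr rfl fun j _ => by rw [Real.rpow_def_of_pos (hy j), mul_comm]
  have hfac : ∀ j, ellOp A b c (u j) x
      = u j x * (ellOp A b 0 (L j) x - quadA A x (fun k => pd k (L j) x) + c x) := by
    intro j
    have hexp : u j =ᶠ[nhds x] fun y => Real.exp (L j y) := by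
      filter_upwards [hpos] with y hy
      exact (Real.exp_log (hy j)).symm
    rw [hexp.ellOp_eq, ellOp_exp A b c (hLc j), ← hexp.eq_of_nhds]
  have hquot : ∀ i j k, pd k (fun y => Real.log (u i y / u j y)) x
      = pd k (L i) x - pd k (L j) x := by
    intro i j k
    have hlog : (fun y => Real.log (u i y / u j y)) =ᶠ[nhds x] fun y => L i y - L j y := by
      filter_upwards [hpos] with y hy
      exact Real.log_div (hy i).ne' (hy j).ne'
    rw [(hlog.pd k).eq_of_nhds]
    simp only [pd]
    rw [fderiv_fun_sub (hLd i) (hLd j)]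
    rfl
  have hdiv : ∀ j, α j * ellOp A b c (u j) x / u j x
      = α j * ellOp A b 0 (L j) x - α j * quadA A x (fun k => pd k (L j) x) + α j * c x := by
    intro j
    rw [hfac]
    have := (hup j).ne'
    field_simp
  simp only [hquot, hdiv, Finset.sum_add_distrib, Finset.sum_sub_distrib, ← Finset.sum_mul, hα]
  rw [sum_filter_lt_quadA_sub A x hα fun j k => pd k (L j) x, hprod.ellOp_eq,
    ellOp_exp A b c (ContDiffAt.sum fun j _ => contDiffAt_const.mul (hLc j)),
    ellOp_sum_mul A b 0 hLc, ← hprod.eq_of_nhds]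
  simp only [pd_sum_mul hLd]
  ring

theorem stmt2 {n : ℕ} (hn : 1 ≤ n) {Ω : Set (Euc n)} (hΩ : IsOpen Ω)
    (A : Euc n → Matrix (Fin n) (Fin n) ℝ) (hAc : ContinuousOn A Ω)
    (hAs : ∀ x ∈ Ω, (A x).IsSymm) (hAp : ∀ x ∈ Ω, (A x).PosDef)
    (b : Euc n → Fin n → ℝ) (hb : ContinuousOn b Ω)
    (c : Euc n → ℝ) (hc : ContinuousOn c Ω)
    (N : ℕ) (hN : 1 ≤ N) (u : Fin N → Euc n → ℝ)
    (hu : ∀ j, ContDiffOn ℝ 2 (u j) Ω)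
    (hup : ∀ j, ∀ x ∈ Ω, 0 < u j x)
    (α : Fin N → ℝ) (hα : ∀ j, 0 ≤ α j) (hαsum : ∑ j, α j = 1)
    (W : Euc n → ℝ)
    (hW : ∀ x ∈ Ω, W x =
      ∑ i, ∑ j ∈ Finset.univ.filter (fun j => i < j),
        α i * α j *
          quadA A x (fun k => pd k (fun y => Real.log (u i y / u j y)) x)) :
    (∀ x ∈ Ω,
      ellOp A b c (fun y => ∏ j, u j y ^ α j) x
        = (∑ j, α j * ellOp A b c (u j) x / u j x) * (∏ j, u j x ^ α j)
          + W x * (∏ j, u j x ^ α j)) ∧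
    ((∀ j, ∀ x ∈ Ω, ellOp A b c (u j) x = 0) →
      ∀ x ∈ Ω, ellOp A b c (fun y => ∏ j, u j y ^ α j) x
        = W x * (∏ j, u j x ^ α j)) ∧
    ((∀ j, ∀ x ∈ Ω, 0 ≤ ellOp A b c (u j) x) →
      ∀ x ∈ Ω, W x * (∏ j, u j x ^ α j)
        ≤ ellOp A b c (fun y => ∏ j, u j y ^ α j) x) := by
  have hmain : ∀ x ∈ Ω, ellOp A b c (fun y => ∏ j, u j y ^ α j) x
      = (∑ j, α j * ellOp A b c (u j) x / u j x) * (∏ j, u j x ^ α j)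
        + W x * (∏ j, u j x ^ α j) := fun x hx => by
    rw [hW x hx]
    exact ellOp_prod_rpow A b c (fun j => (hu j).contDiffAt (hΩ.mem_nhds hx))
      (fun j => hup j x hx) hαsum
  refine ⟨hmain, fun h x hx => ?_, fun h x hx => ?_⟩
  · simp [hmain x hx, h _ x hx]
  · rw [hmain x hx]
    refine le_add_of_nonneg_left (mul_nonneg (Finset.sum_nonneg fun j _ => ?_)
      (Finset.prod_nonneg fun j _ => (Real.rpow_pos_of_pos (hup j x hx) _).le))
    exact div_nonneg (mul_nonneg (hα j) (h j x hx)) (hup j x hx).le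
end
end

section
/- Let v₀, v₁ : Ω → ℝ be twice continuously differentiable and positive on Ω with P v₀ = 0 and P v₁ = 0 on Ω, and set W(x) := ¼ |∇ log(v₁/v₀)(x)|²_{A(x)}. Let λ ∈ ℝ and let α ∈ ℂ satisfy 4α(1−α) = λ. Then the complex-valued function v_α : Ω → ℂ defined by v_α(x) := v₀(x) · exp(α · log(v₁(x)/v₀(x))) satisfies P v_α = λ · W · v_α pointwise on Ω, where P is applied separately to the real and imaginary parts. -/
open MeasureTheory Finset

noncomputable section

open scoped Topology ContDiff

section PartialDerivatives

variable {n : ℕ} {u v φ : Euc n → ℝ} {x : Euc n}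

lemma pd_congr (h : u =ᶠ[𝓝 x] v) (i : Fin n) : pd i u x = pd i v x := by
  simp only [pd, h.fderiv_eq]

lemma pd2_eq_pd_pd (i j : Fin n) (u : Euc n → ℝ) (x : Euc n) :
    pd2 i j u x = pd i (pd j u) x := rfl

lemma eventuallyEq_pd (h : u =ᶠ[𝓝 x] v) (i : Fin n) : pd i u =ᶠ[𝓝 x] pd i v := by
  filter_upwards [h.eventuallyEq_nhds] with y hy using pd_congr hy i

lemma pd2_congr (h : u =ᶠ[𝓝 x] v) (i j : Fin n) : pd2 i j u x = pd2 i j v x :=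
  pd_congr (eventuallyEq_pd h j) i

lemma ellOp_congr (A : Euc n → Matrix (Fin n) (Fin n) ℝ) (b : Euc n → Fin n → ℝ)
    (c : Euc n → ℝ) (h : u =ᶠ[𝓝 x] v) : ellOp A b c u x = ellOp A b c v x := by
  simp only [ellOp, pd_congr h, pd2_congr h, h.eq_of_nhds]

lemma pd_add (hu : DifferentiableAt ℝ u x) (hv : DifferentiableAt ℝ v x) (i : Fin n) :
    pd i (fun y => u y + v y) x = pd i u x + pd i v x := by
  simp [pd, fderiv_fun_add hu hv]

lemma pd_mul (hu : DifferentiableAt ℝ u x) (hv : DifferentiableAt ℝ v x) (i : Fin n) :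
    pd i (fun y => u y * v y) x = u x * pd i v x + v x * pd i u x := by
  simp [pd, fderiv_fun_mul hu hv]

lemma pd_comp {g : ℝ → ℝ} {m : ℝ} (hg : HasDerivAt g m (φ x)) (hφ : DifferentiableAt ℝ φ x)
    (i : Fin n) : pd i (fun y => g (φ y)) x = m * pd i φ x := by
  have h : HasFDerivAt (fun y => g (φ y)) (m • fderiv ℝ φ x) x :=
    hg.comp_hasFDerivAt x hφ.hasFDerivAt
  simp [pd, h.fderiv]

lemma ContDiffAt.differentiableAt_pd_s3 (hu : ContDiffAt ℝ 2 u x) (i : Fin n) :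
    DifferentiableAt ℝ (pd i u) x :=
  ((hu.fderiv_right (m := 1) (by norm_num)).differentiableAt (by norm_num)).clm_apply
    (differentiableAt_const _)

lemma pd_mul_comp {g g' : ℝ → ℝ} (hg : ∀ t, HasDerivAt g (g' t) t)
    (hv : DifferentiableAt ℝ v x) (hφ : DifferentiableAt ℝ φ x) (i : Fin n) :
    pd i (fun y => v y * g (φ y)) x = v x * (g' (φ x) * pd i φ x) + g (φ x) * pd i v x := by
  have hgφ : DifferentiableAt ℝ (fun y => g (φ y)) x :=
    (hg (φ x)).differentiableAt.comp x hφ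
  rw [pd_mul hv hgφ, pd_comp (hg (φ x)) hφ]

lemma pd2_mul_comp {g g' g'' : ℝ → ℝ} (hg : ∀ t, HasDerivAt g (g' t) t)
    (hg' : ∀ t, HasDerivAt g' (g'' t) t) (hv : ContDiffAt ℝ 2 v x) (hφ : ContDiffAt ℝ 2 φ x)
    (i j : Fin n) :
    pd2 i j (fun y => v y * g (φ y)) x = g (φ x) * pd2 i j v x
      + g' (φ x) * (pd i φ x * pd j v x + pd i v x * pd j φ x + v x * pd2 i j φ x)
      + g'' (φ x) * v x * (pd i φ x * pd j φ x) := by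
  have hev : pd j (fun y => v y * g (φ y)) =ᶠ[𝓝 x]
      fun y => v y * (g' (φ y) * pd j φ y) + g (φ y) * pd j v y := by
    filter_upwards [hv.eventually (by simp), hφ.eventually (by simp)] with y hvy hφy
    exact pd_mul_comp hg (hvy.differentiableAt (by norm_num))
      (hφy.differentiableAt (by norm_num)) j
  have hvd : DifferentiableAt ℝ v x := hv.differentiableAt (by norm_num)
  have hφd : DifferentiableAt ℝ φ x := hφ.differentiableAt (by norm_num)
  have hgφ : DifferentiableAt ℝ (fun y => g (φ y)) x :=
    (hg (φ x)).differentiableAt.comp x hφd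
  have hg'φ : DifferentiableAt ℝ (fun y => g' (φ y)) x :=
    (hg' (φ x)).differentiableAt.comp x hφd
  have hvj := hv.differentiableAt_pd_s3 j
  have hφj := hφ.differentiableAt_pd_s3 j
  rw [pd2_eq_pd_pd, pd_congr hev, pd_add (hvd.fun_mul (hg'φ.fun_mul hφj)) (hgφ.fun_mul hvj),
    pd_mul hvd (hg'φ.fun_mul hφj), pd_mul hg'φ hφj, pd_mul hgφ hvj, pd_comp (hg (φ x)) hφd,
    pd_comp (hg' (φ x)) hφd, pd2_eq_pd_pd, pd2_eq_pd_pd]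
  ring

end PartialDerivatives

section GroundStateTransform

variable {n : ℕ}

/-- The coefficient of `g' (φ x)` in the expansion of `P (v · g ∘ φ)` at `x`. -/
def ellCross (A : Euc n → Matrix (Fin n) (Fin n) ℝ) (b : Euc n → Fin n → ℝ)
    (v φ : Euc n → ℝ) (x : Euc n) : ℝ :=
  -(∑ i, ∑ j, A x i j * (pd i φ x * pd j v x + pd i v x * pd j φ x + v x * pd2 i j φ x))
    + ∑ i, b x i * (v x * pd i φ x)

variable (A : Euc n → Matrix (Fin n) (Fin n) ℝ) (b : Euc n → Fin n → ℝ) (c : Euc n → ℝ)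
  {v φ : Euc n → ℝ} {x : Euc n}

lemma ellOp_mul_comp {g g' g'' : ℝ → ℝ} (hg : ∀ t, HasDerivAt g (g' t) t)
    (hg' : ∀ t, HasDerivAt g' (g'' t) t) (hv : ContDiffAt ℝ 2 v x)
    (hφ : ContDiffAt ℝ 2 φ x) :
    ellOp A b c (fun y => v y * g (φ y)) x = g (φ x) * ellOp A b c v x
      + g' (φ x) * ellCross A b v φ x
      - g'' (φ x) * v x * quadA A x (fun i => pd i φ x) := by
  have hfst : ∑ i, b x i * pd i (fun y => v y * g (φ y)) x
      = g (φ x) * ∑ i, b x i * pd i v x + g' (φ x) * ∑ i, b x i * (v x * pd i φ x) := by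
    simp only [mul_sum, ← sum_add_distrib]
    refine sum_congr rfl fun i _ => ?_
    rw [pd_mul_comp hg (hv.differentiableAt (by norm_num)) (hφ.differentiableAt (by norm_num))]
    ring
  have hsnd : ∑ i, ∑ j, A x i j * pd2 i j (fun y => v y * g (φ y)) x
      = g (φ x) * (∑ i, ∑ j, A x i j * pd2 i j v x)
        + g' (φ x) * (∑ i, ∑ j,
          A x i j * (pd i φ x * pd j v x + pd i v x * pd j φ x + v x * pd2 i j φ x))
        + g'' (φ x) * v x * quadA A x (fun i => pd i φ x) := by
    simp only [quadA, mul_sum, ← sum_add_distrib]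
    refine sum_congr rfl fun i _ => sum_congr rfl fun j _ => ?_
    rw [pd2_mul_comp hg hg' hv hφ]
    ring
  simp only [ellOp, ellCross, hfst, hsnd]
  ring

/-- If `v` and `v · exp φ` are both annihilated by `P`, then `P` acts on `v · g ∘ φ` through the
ordinary differential operator `g ↦ g' - g''`. -/
lemma ellOp_mul_comp_of_eq_zero {g g' g'' : ℝ → ℝ} (hg : ∀ t, HasDerivAt g (g' t) t)
    (hg' : ∀ t, HasDerivAt g' (g'' t) t) (hv : ContDiffAt ℝ 2 v x)
    (hφ : ContDiffAt ℝ 2 φ x) (h₀ : ellOp A b c v x = 0)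
    (h₁ : ellOp A b c (fun y => v y * Real.exp (φ y)) x = 0) :
    ellOp A b c (fun y => v y * g (φ y)) x
      = (g' (φ x) - g'' (φ x)) * v x * quadA A x (fun i => pd i φ x) := by
  rw [ellOp_mul_comp A b c Real.hasDerivAt_exp Real.hasDerivAt_exp hv hφ, h₀] at h₁
  have hcross : ellCross A b v φ x = v x * quadA A x (fun i => pd i φ x) := by
    refine mul_left_cancel₀ (Real.exp_ne_zero (φ x)) ?_
    linarith
  rw [ellOp_mul_comp A b c hg hg' hv hφ, h₀, hcross]
  ring

end GroundStateTransform

lemma hasDerivAt_const_mul_cexp_mul (k α : ℂ) (t : ℝ) :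
    HasDerivAt (fun s : ℝ => k * Complex.exp (α * s)) (α * k * Complex.exp (α * t)) t := by
  have h := (((Complex.ofRealCLM.hasDerivAt (x := t)).const_mul α).cexp).const_mul k
  refine h.congr_deriv ?_
  simp only [Complex.ofRealCLM_apply, Complex.ofReal_one]
  ring

theorem stmt3 {n : ℕ} (hn : 1 ≤ n) {Ω : Set (Euc n)} (hΩ : IsOpen Ω)
    (A : Euc n → Matrix (Fin n) (Fin n) ℝ) (hAc : ContinuousOn A Ω)
    (hAs : ∀ x ∈ Ω, (A x).IsSymm) (hAp : ∀ x ∈ Ω, (A x).PosDef)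
    (b : Euc n → Fin n → ℝ) (hb : ContinuousOn b Ω)
    (c : Euc n → ℝ) (hc : ContinuousOn c Ω)
    (v₀ v₁ : Euc n → ℝ)
    (hv₀ : ContDiffOn ℝ 2 v₀ Ω) (hv₁ : ContDiffOn ℝ 2 v₁ Ω)
    (hv₀p : ∀ x ∈ Ω, 0 < v₀ x) (hv₁p : ∀ x ∈ Ω, 0 < v₁ x)
    (hPv₀ : ∀ x ∈ Ω, ellOp A b c v₀ x = 0)
    (hPv₁ : ∀ x ∈ Ω, ellOp A b c v₁ x = 0)
    (W : Euc n → ℝ)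
    (hW : ∀ x ∈ Ω, W x =
      (1 / 4) * quadA A x (fun i => pd i (fun y => Real.log (v₁ y / v₀ y)) x))
    (lam : ℝ) (α : ℂ) (hα : 4 * α * (1 - α) = (lam : ℂ))
    (vα : Euc n → ℂ)
    (hvα : ∀ x, vα x =
      (v₀ x : ℂ) * Complex.exp (α * (Real.log (v₁ x / v₀ x) : ℂ))) :
    ∀ x ∈ Ω,
      ellOp A b c (fun y => (vα y).re) x = lam * W x * (vα x).re ∧
      ellOp A b c (fun y => (vα y).im) x = lam * W x * (vα x).im := by
  intro x hx
  have hnhds : Ω ∈ 𝓝 x := hΩ.mem_nhds hx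
  have h₀ : ContDiffAt ℝ 2 v₀ x := hv₀.contDiffAt hnhds
  have h₁ : ContDiffAt ℝ 2 v₁ x := hv₁.contDiffAt hnhds
  have hφ : ContDiffAt ℝ 2 (fun y => Real.log (v₁ y / v₀ y)) x :=
    (h₁.div h₀ (hv₀p x hx).ne').log (div_pos (hv₁p x hx) (hv₀p x hx)).ne'
  have hexp : ellOp A b c (fun y => v₀ y * Real.exp (Real.log (v₁ y / v₀ y))) x = 0 := by
    rw [← hPv₁ x hx]
    refine ellOp_congr A b c ?_
    filter_upwards [hnhds] with y hy
    rw [Real.exp_log (div_pos (hv₁p y hy) (hv₀p y hy)), mul_div_cancel₀ _ (hv₀p y hy).ne']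
  have key : ∀ L : ℂ →L[ℝ] ℝ, ellOp A b c (fun y => L (vα y)) x = lam * W x * L (vα x) := by
    intro L
    have hL : ∀ (r : ℝ) (z : ℂ), L (r * z) = r * L z := fun r z => by
      rw [← Complex.real_smul, map_smul, smul_eq_mul]
    have hderiv : ∀ (k : ℂ) (t : ℝ), HasDerivAt (fun s : ℝ => L (k * Complex.exp (α * s)))
        (L (α * k * Complex.exp (α * t))) t := fun k t =>
      L.hasFDerivAt.comp_hasDerivAt t (hasDerivAt_const_mul_cexp_mul k α t)
    have hmain := ellOp_mul_comp_of_eq_zero A b c (hderiv 1) (hderiv (α * 1)) h₀ hφ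
      (hPv₀ x hx) hexp
    simp only [one_mul, mul_one] at hmain
    simp only [hvα, hL, hW x hx]
    rw [hmain, ← map_sub]
    have hode : ∀ e : ℂ, α * e - α * α * e = ((lam / 4 : ℝ) : ℂ) * e := fun e => by
      push_cast
      rw [← hα]
      ring
    rw [hode, hL]
    ring
  exact ⟨key Complex.reCLM, key Complex.imCLM⟩
end
end

section
/- Let v₀, v₁ : Ω → ℝ be twice continuously differentiable and positive on Ω with P v₀ = 0 and P v₁ = 0 on Ω, and set W(x) := ¼ |∇ log(v₀/v₁)(x)|²_{A(x)}. Then the Hardy-type inequality ∫_Ω (|∇φ(x)|²_{A(x)} + c(x) φ(x)²) dx ≥ ∫_Ω W(x) φ(x)² dx holds for every φ ∈ C_c^∞(Ω). -/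
open MeasureTheory Finset

noncomputable section

/-- The symmetric divergence-form operator
`(P u)(x) = −∑ᵢ ∂ᵢ(∑ⱼ A(x)ᵢⱼ ∂ⱼu)(x) + c(x) u(x)`. -/
def divOp {n : ℕ} (A : Euc n → Matrix (Fin n) (Fin n) ℝ)
    (c : Euc n → ℝ) (u : Euc n → ℝ) (x : Euc n) : ℝ :=
  -(∑ i, pd i (fun y => ∑ j, A y i j * pd j u y) x) + c x * u x

open Matrix in
lemma quadA_eq_dotProduct {n : ℕ} (A : Euc n → Matrix (Fin n) (Fin n) ℝ) (x : Euc n)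
    (ξ : Fin n → ℝ) : quadA A x ξ = ξ ⬝ᵥ (A x *ᵥ ξ) := by
  simp only [quadA, dotProduct, mulVec, Finset.mul_sum, mul_assoc]

open Matrix in
/-- Completing the square around the average of `p` and `q`. -/
lemma quarter_dotProduct_sub_le {n : ℕ} {M : Matrix (Fin n) (Fin n) ℝ} (hMs : M.IsSymm)
    (hM : M.PosSemidef) (ξ p q : Fin n → ℝ) (t c : ℝ) :
    (1 / 4) * ((p - q) ⬝ᵥ (M *ᵥ (p - q))) * t ^ 2
      + (1 / 2) * ((2 * t * (ξ ⬝ᵥ (M *ᵥ p)) + t ^ 2 * (c - p ⬝ᵥ (M *ᵥ p)))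
        + (2 * t * (ξ ⬝ᵥ (M *ᵥ q)) + t ^ 2 * (c - q ⬝ᵥ (M *ᵥ q))))
      ≤ ξ ⬝ᵥ (M *ᵥ ξ) + c * t ^ 2 := by
  have hsymm : ∀ a b : Fin n → ℝ, a ⬝ᵥ (M *ᵥ b) = b ⬝ᵥ (M *ᵥ a) := fun a b => by
    rw [dotProduct_mulVec, ← mulVec_transpose, hMs.eq, dotProduct_comm]
  have h := hM.dotProduct_mulVec_nonneg (ξ - (t / 2) • (p + q))
  simp only [star_trivial, mulVec_sub, mulVec_add, mulVec_smul, dotProduct_sub, dotProduct_add,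
    dotProduct_smul, sub_dotProduct, add_dotProduct, smul_dotProduct, smul_eq_mul] at h ⊢
  rw [hsymm p ξ, hsymm q ξ, hsymm q p] at h
  rw [hsymm q p]
  linarith

lemma integrableOn_of_continuousOn_of_support_subset {E : Type*} [TopologicalSpace E]
    [T2Space E] [MeasurableSpace E] [OpensMeasurableSpace E] {μ : Measure E}
    [IsFiniteMeasureOnCompacts μ] {Ω K : Set E} {f : E → ℝ} (hf : ContinuousOn f Ω)
    (hK : IsCompact K) (hKΩ : K ⊆ Ω) (hfK : Function.support f ⊆ K) : IntegrableOn f Ω μ :=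
  ((integrableOn_iff_integrable_of_support_subset hfK).1
    ((hf.mono hKΩ).integrableOn_compact hK)).integrableOn

lemma ContDiff.of_contDiffOn_of_tsupport_subset {E F : Type*} [NormedAddCommGroup E]
    [NormedSpace ℝ E] [NormedAddCommGroup F] [NormedSpace ℝ F] {k : WithTop ℕ∞} {Ω : Set E}
    {f : E → F} (hΩ : IsOpen Ω) (hf : ContDiffOn ℝ k f Ω) (hfΩ : tsupport f ⊆ Ω) :
    ContDiff ℝ k f := by
  refine contDiff_iff_contDiffAt.2 fun x => ?_
  by_cases hx : x ∈ tsupport f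
  · exact hf.contDiffAt (hΩ.mem_nhds (hfΩ hx))
  · exact contDiffAt_const.congr_of_eventuallyEq (notMem_tsupport_iff_eventuallyEq.1 hx)

lemma HasCompactSupport.integrable_fderiv_apply {n : ℕ} {f : Euc n → ℝ}
    (hf : HasCompactSupport f) (hf1 : ContDiff ℝ 1 f) (v : Euc n) :
    Integrable (fun x => fderiv ℝ f x v) :=
  ((hf1.continuous_fderiv one_ne_zero).clm_apply continuous_const).integrable_of_hasCompactSupport
    (hf.fderiv_apply ℝ v)

lemma HasCompactSupport.integral_fderiv_apply_eq_zero {n : ℕ} {f : Euc n → ℝ}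
    (hf : HasCompactSupport f) (hf1 : ContDiff ℝ 1 f) (v : Euc n) :
    ∫ x, fderiv ℝ f x v = 0 := by
  have hint := hf.integrable_fderiv_apply hf1 v
  simpa using integral_mul_fderiv_eq_neg_fderiv_mul_of_integrable (μ := volume)
    (f := fun _ : Euc n => (1 : ℝ)) (g := f) (v := v) (by simp) (by simpa using hint)
    (by simpa using hf1.continuous.integrable_of_hasCompactSupport hf)
    (fun x _ => differentiableAt_const _) (fun x _ => hf1.differentiable one_ne_zero x)

lemma ContDiffOn.pd {n : ℕ} {k m : WithTop ℕ∞} {Ω : Set (Euc n)} {u : Euc n → ℝ}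
    (hu : ContDiffOn ℝ k u Ω) (hΩ : IsOpen Ω) (hmk : m + 1 ≤ k) (i : Fin n) :
    ContDiffOn ℝ m (pd i u) Ω :=
  (hu.fderiv_of_isOpen hΩ hmk).clm_apply contDiffOn_const

lemma pd_log_div_s5 {n : ℕ} {u v : Euc n → ℝ} {x : Euc n} (hu : DifferentiableAt ℝ u x)
    (hv : DifferentiableAt ℝ v x) (hux : 0 < u x) (hvx : 0 < v x)
    (hpu : ∀ᶠ y in nhds x, 0 < u y) (hpv : ∀ᶠ y in nhds x, 0 < v y) (i : Fin n) :
    pd i (fun y => Real.log (u y / v y)) x = pd i u x / u x - pd i v x / v x := by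
  have heq : (fun y => Real.log (u y / v y)) =ᶠ[nhds x]
      fun y => Real.log (u y) - Real.log (v y) := by
    filter_upwards [hpu, hpv] with y h1 h2
    exact Real.log_div h1.ne' h2.ne'
  rw [pd, (((hu.hasFDerivAt.log hux.ne').sub
    (hv.hasFDerivAt.log hvx.ne')).congr_of_eventuallyEq heq).fderiv]
  simp [pd, div_eq_inv_mul]

/-- The flux `φ² (A ∇v)ᵢ / v`. -/
def flux {n : ℕ} (A : Euc n → Matrix (Fin n) (Fin n) ℝ) (v φ : Euc n → ℝ) (i : Fin n)
    (x : Euc n) : ℝ :=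
  φ x ^ 2 * ((∑ j, A x i j * pd j v x) * (v x)⁻¹)

section Flux

variable {n : ℕ} {Ω : Set (Euc n)} {A : Euc n → Matrix (Fin n) (Fin n) ℝ} {c v φ : Euc n → ℝ}

lemma contDiffOn_sum_mul_pd (hΩ : IsOpen Ω)
    (hA : ∀ i j, ContDiffOn ℝ 1 (fun x => A x i j) Ω) (hv : ContDiffOn ℝ 2 v Ω) (i : Fin n) :
    ContDiffOn ℝ 1 (fun x => ∑ j, A x i j * pd j v x) Ω :=
  ContDiffOn.sum fun j _ => (hA i j).mul (hv.pd hΩ (by norm_num) j)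

open Matrix in
lemma sum_pd_flux (hΩ : IsOpen Ω) (hA : ∀ i j, ContDiffOn ℝ 1 (fun x => A x i j) Ω)
    (hv : ContDiffOn ℝ 2 v Ω) (hvp : ∀ x ∈ Ω, 0 < v x) (hPv : ∀ x ∈ Ω, divOp A c v x = 0)
    (hφ : ContDiff ℝ 1 φ) {x : Euc n} (hx : x ∈ Ω) :
    ∑ i, pd i (flux A v φ i) x =
      2 * φ x * ((fun i => pd i φ x) ⬝ᵥ (A x *ᵥ fun i => pd i v x / v x))
        + φ x ^ 2 * (c x
          - (fun i => pd i v x / v x) ⬝ᵥ (A x *ᵥ fun i => pd i v x / v x)) := by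
  have hvx := (hvp x hx).ne'
  have hB : ∀ i, HasFDerivAt (fun y => ∑ j, A y i j * pd j v y) _ x := fun i =>
    (((contDiffOn_sum_mul_pd hΩ hA hv i).contDiffAt (hΩ.mem_nhds hx)).differentiableAt
      one_ne_zero).hasFDerivAt
  have hvd : HasFDerivAt v _ x :=
    ((hv.contDiffAt (hΩ.mem_nhds hx)).differentiableAt two_ne_zero).hasFDerivAt
  have hφd : HasFDerivAt φ _ x := (hφ.differentiable one_ne_zero x).hasFDerivAt
  have hpd : ∀ i, pd i (flux A v φ i) x =
      2 * φ x * (pd i φ x * ((∑ j, A x i j * pd j v x) / v x))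
        + φ x ^ 2 * (pd i (fun y => ∑ j, A y i j * pd j v y) x / v x
          - pd i v x / v x * ((∑ j, A x i j * pd j v x) / v x)) := fun i => by
    have h := (hφd.pow 2).mul ((hB i).mul ((hasDerivAt_inv hvx).comp_hasFDerivAt x hvd))
    have h' : HasFDerivAt (flux A v φ i) _ x := h
    rw [pd, h'.fderiv]
    simp only [pd, _root_.add_apply, _root_.smul_apply,
      smul_eq_mul, Function.comp_apply, nsmul_eq_mul, Pi.mul_apply]
    field_simp
    push_cast
    ring
  have hdiv : ∑ i, pd i (fun y => ∑ j, A y i j * pd j v y) x = c x * v x := by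
    have := hPv x hx
    rw [divOp] at this
    linarith
  have hMp : ∀ i, (A x *ᵥ fun i => pd i v x / v x) i = (∑ j, A x i j * pd j v x) / v x :=
    fun i => by simp only [mulVec, dotProduct, Finset.sum_div, mul_div_assoc]
  simp only [hpd, Finset.sum_add_distrib, ← Finset.mul_sum, Finset.sum_sub_distrib,
    ← Finset.sum_div, hdiv, dotProduct, hMp]
  rw [mul_div_cancel_right₀ _ hvx]

lemma tsupport_flux_subset (i : Fin n) : tsupport (flux A v φ i) ⊆ tsupport φ :=
  closure_mono fun x hx h => hx (by simp [flux, h])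

lemma hasCompactSupport_flux (hφc : HasCompactSupport φ) (i : Fin n) :
    HasCompactSupport (flux A v φ i) :=
  hφc.of_isClosed_subset (isClosed_tsupport _) (tsupport_flux_subset i)

lemma contDiff_flux (hΩ : IsOpen Ω) (hA : ∀ i j, ContDiffOn ℝ 1 (fun x => A x i j) Ω)
    (hv : ContDiffOn ℝ 2 v Ω) (hvp : ∀ x ∈ Ω, 0 < v x) (hφ : ContDiff ℝ 1 φ)
    (hφΩ : tsupport φ ⊆ Ω) (i : Fin n) : ContDiff ℝ 1 (flux A v φ i) :=
  ContDiff.of_contDiffOn_of_tsupport_subset hΩ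
    ((hφ.pow 2).contDiffOn.mul ((contDiffOn_sum_mul_pd hΩ hA hv i).mul
      ((hv.of_le (by norm_num)).inv fun x hx => (hvp x hx).ne')))
    ((tsupport_flux_subset i).trans hφΩ)

lemma integrable_sum_pd_flux (hΩ : IsOpen Ω) (hA : ∀ i j, ContDiffOn ℝ 1 (fun x => A x i j) Ω)
    (hv : ContDiffOn ℝ 2 v Ω) (hvp : ∀ x ∈ Ω, 0 < v x) (hφ : ContDiff ℝ 1 φ)
    (hφc : HasCompactSupport φ) (hφΩ : tsupport φ ⊆ Ω) :
    Integrable (fun x => ∑ i, pd i (flux A v φ i) x) :=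
  integrable_finsetSum _ fun i _ =>
    (hasCompactSupport_flux hφc i).integrable_fderiv_apply
      (contDiff_flux hΩ hA hv hvp hφ hφΩ i) _

lemma setIntegral_sum_pd_flux (hΩ : IsOpen Ω)
    (hA : ∀ i j, ContDiffOn ℝ 1 (fun x => A x i j) Ω)
    (hv : ContDiffOn ℝ 2 v Ω) (hvp : ∀ x ∈ Ω, 0 < v x) (hφ : ContDiff ℝ 1 φ)
    (hφc : HasCompactSupport φ) (hφΩ : tsupport φ ⊆ Ω) :
    ∫ x in Ω, ∑ i, pd i (flux A v φ i) x = 0 := by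
  have hc := hasCompactSupport_flux (A := A) (v := v) hφc
  have hd := contDiff_flux hΩ hA hv hvp hφ hφΩ
  rw [setIntegral_eq_integral_of_forall_compl_eq_zero, integral_finsetSum]
  · exact Finset.sum_eq_zero fun i _ => (hc i).integral_fderiv_apply_eq_zero (hd i) _
  · exact fun i _ => (hc i).integrable_fderiv_apply (hd i) _
  · intro x hx
    refine Finset.sum_eq_zero fun i _ => ?_
    rw [pd, fderiv_of_notMem_tsupport ℝ
      fun h => hx (hφΩ (tsupport_flux_subset i h))]
    rfl

end Flux

theorem stmt5 {n : ℕ} (hn : 1 ≤ n) {Ω : Set (Euc n)} (hΩ : IsOpen Ω)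
    (A : Euc n → Matrix (Fin n) (Fin n) ℝ) (hAc : ∀ i j, ContDiffOn ℝ 1 (fun x => A x i j) Ω)
    (hAs : ∀ x ∈ Ω, (A x).IsSymm) (hAp : ∀ x ∈ Ω, (A x).PosDef)
    (c : Euc n → ℝ) (hc : ContinuousOn c Ω)
    (v₀ v₁ : Euc n → ℝ)
    (hv₀ : ContDiffOn ℝ 2 v₀ Ω) (hv₁ : ContDiffOn ℝ 2 v₁ Ω)
    (hv₀p : ∀ x ∈ Ω, 0 < v₀ x) (hv₁p : ∀ x ∈ Ω, 0 < v₁ x)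
    (hPv₀ : ∀ x ∈ Ω, divOp A c v₀ x = 0)
    (hPv₁ : ∀ x ∈ Ω, divOp A c v₁ x = 0)
    (W : Euc n → ℝ)
    (hW : ∀ x ∈ Ω, W x =
      (1 / 4) * quadA A x (fun i => pd i (fun y => Real.log (v₀ y / v₁ y)) x)) :
    ∀ φ : Euc n → ℝ, ContDiff ℝ (⊤ : ℕ∞) φ → HasCompactSupport φ → tsupport φ ⊆ Ω →
      ∫ x in Ω, W x * φ x ^ 2 ≤
        ∫ x in Ω, (quadA A x (fun i => pd i φ x) + c x * φ x ^ 2) := by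
  intro φ hφ hφc hφΩ
  have hφ1 : ContDiff ℝ 1 φ := hφ.of_le (by exact_mod_cast le_top)
  have hWeq : ∀ x ∈ Ω, W x =
      (1 / 4) * quadA A x (fun i => pd i v₀ x / v₀ x - pd i v₁ x / v₁ x) := fun x hx => by
    have hn := hΩ.mem_nhds hx
    rw [hW x hx]
    congr 2
    funext i
    exact pd_log_div_s5 ((hv₀.contDiffAt hn).differentiableAt two_ne_zero)
      ((hv₁.contDiffAt hn).differentiableAt two_ne_zero) (hv₀p x hx) (hv₁p x hx)
      (Filter.mem_of_superset hn hv₀p) (Filter.mem_of_superset hn hv₁p) i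
  have hquad : ∀ ξ : Euc n → Fin n → ℝ, (∀ i, ContinuousOn (fun x => ξ x i) Ω) →
      ContinuousOn (fun x => quadA A x (ξ x)) Ω := fun ξ hξ =>
    continuousOn_finsetSum _ fun i _ => continuousOn_finsetSum _ fun j _ =>
      ((hξ i).mul (hAc i j).continuousOn).mul (hξ j)
  have hlog : ∀ v : Euc n → ℝ, ContDiffOn ℝ 2 v Ω → (∀ x ∈ Ω, 0 < v x) → ∀ i,
      ContinuousOn (fun x => pd i v x / v x) Ω := fun v hv hvp i =>
    (hv.pd (m := 1) hΩ (by norm_num) i).continuousOn.div hv.continuousOn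
      fun x hx => (hvp x hx).ne'
  have hWc : ContinuousOn W Ω :=
    (continuousOn_const.mul (hquad _ fun i =>
      (hlog v₀ hv₀ hv₀p i).sub (hlog v₁ hv₁ hv₁p i))).congr hWeq
  have hφ2 : ContinuousOn (fun x => φ x ^ 2) Ω := (hφ.continuous.pow 2).continuousOn
  have hWint : IntegrableOn (fun x => W x * φ x ^ 2) Ω :=
    integrableOn_of_continuousOn_of_support_subset (hWc.mul hφ2) hφc hφΩ fun x hx => by
      by_contra h
      exact hx (by simp [image_eq_zero_of_notMem_tsupport h])
  have hRint : IntegrableOn (fun x => quadA A x (fun i => pd i φ x) + c x * φ x ^ 2) Ω :=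
    integrableOn_of_continuousOn_of_support_subset
      ((hquad _ fun i => (hφ1.contDiffOn.pd (m := 0) hΩ (by norm_num) i).continuousOn).add
        (hc.mul hφ2)) hφc hφΩ fun x hx => by
      by_contra h
      exact hx (by simp [image_eq_zero_of_notMem_tsupport h, quadA, pd,
        fderiv_of_notMem_tsupport ℝ h])
  have hint₀ := (integrable_sum_pd_flux hΩ hAc hv₀ hv₀p hφ1 hφc hφΩ).integrableOn (s := Ω)
  have hint₁ := (integrable_sum_pd_flux hΩ hAc hv₁ hv₁p hφ1 hφc hφΩ).integrableOn (s := Ω)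
  have hFint : IntegrableOn (fun x => (1 / 2) * (∑ i, pd i (flux A v₀ φ i) x
      + ∑ i, pd i (flux A v₁ φ i) x)) Ω := (hint₀.add hint₁).const_mul (1 / 2)
  calc ∫ x in Ω, W x * φ x ^ 2
      = ∫ x in Ω, (W x * φ x ^ 2 + (1 / 2) * (∑ i, pd i (flux A v₀ φ i) x
          + ∑ i, pd i (flux A v₁ φ i) x)) := by
        rw [integral_add hWint hFint, integral_const_mul, integral_add hint₀ hint₁,
          setIntegral_sum_pd_flux hΩ hAc hv₀ hv₀p hφ1 hφc hφΩ,
          setIntegral_sum_pd_flux hΩ hAc hv₁ hv₁p hφ1 hφc hφΩ]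
        simp
    _ ≤ _ := by
        refine setIntegral_mono_on (hWint.add hFint) hRint hΩ.measurableSet fun x hx => ?_
        rw [hWeq x hx, sum_pd_flux hΩ hAc hv₀ hv₀p hPv₀ hφ1 hx,
          sum_pd_flux hΩ hAc hv₁ hv₁p hPv₁ hφ1 hx, quadA_eq_dotProduct, quadA_eq_dotProduct]
        exact quarter_dotProduct_sub_le (hAs x hx) (hAp x hx).posSemidef _ _ _ _ _
end
end

section
/- The operator −Δ − C_H |x|^{−2} is critical in ℝⁿ \ {0} in the sense that its Hardy weight cannot be improved: if V : ℝⁿ \ {0} → ℝ is continuous, V(x) ≥ C_H/|x|² for every x ≠ 0, and V(x₀) > C_H/|x₀|² for at least one point x₀ ≠ 0, then there exists φ ∈ C_c^∞(ℝⁿ \ {0}) with ∫ |∇φ(x)|² dx < ∫ V(x) φ(x)² dx. -/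
open MeasureTheory

noncomputable section

open Set Metric Filter Topology

/-- The radial function `x ↦ G (log ‖x‖)`, extended by zero at the origin. -/
def logRadial {n : ℕ} (G : ℝ → ℝ) (x : Euc n) : ℝ := if x = 0 then 0 else G (Real.log ‖x‖)

lemma logRadial_of_ne {n : ℕ} (G : ℝ → ℝ) {x : Euc n} (hx : x ≠ 0) :
    logRadial G x = G (Real.log ‖x‖) := if_neg hx

lemma log_norm_eq_half_log_norm_sq {n : ℕ} (x : Euc n) :
    Real.log ‖x‖ = 1 / 2 * Real.log (‖x‖ ^ 2) := by
  rw [Real.log_pow]; push_cast; ring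

lemma logRadial_eventuallyEq {n : ℕ} (G : ℝ → ℝ) {x : Euc n} (hx : x ≠ 0) :
    logRadial G =ᶠ[𝓝 x] fun y => G (1 / 2 * Real.log (‖y‖ ^ 2)) := by
  filter_upwards [isOpen_ne.mem_nhds hx] with y hy
  rw [logRadial_of_ne G hy, log_norm_eq_half_log_norm_sq]

lemma norm_mem_Icc_of_logRadial_ne_zero {n : ℕ} {G : ℝ → ℝ} {M : ℝ}
    (hM : ∀ t, M < |t| → G t = 0) {x : Euc n} (hx : logRadial G x ≠ 0) :
    ‖x‖ ∈ Icc (Real.exp (-M)) (Real.exp M) := by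
  have hx0 : x ≠ 0 := by
    rintro rfl
    simp [logRadial] at hx
  rw [logRadial_of_ne G hx0] at hx
  have hle : |Real.log ‖x‖| ≤ M := by
    by_contra! h
    exact hx (hM _ h)
  have hpos := norm_pos_iff.2 hx0
  rw [abs_le] at hle
  exact ⟨(Real.le_log_iff_exp_le hpos).1 hle.1, (Real.log_le_iff_le_exp hpos).1 hle.2⟩

lemma tsupport_logRadial_subset {n : ℕ} {G : ℝ → ℝ} {M : ℝ}
    (hM : ∀ t, M < |t| → G t = 0) :
    tsupport (logRadial (n := n) G) ⊆ {x | ‖x‖ ∈ Icc (Real.exp (-M)) (Real.exp M)} :=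
  closure_minimal (fun _ hx => norm_mem_Icc_of_logRadial_ne_zero hM hx)
    (isClosed_Icc.preimage continuous_norm)

lemma tsupport_logRadial_subset_ne {n : ℕ} {G : ℝ → ℝ} {M : ℝ}
    (hM : ∀ t, M < |t| → G t = 0) :
    tsupport (logRadial (n := n) G) ⊆ {x | x ≠ 0} := fun x hx => by
  have h := (tsupport_logRadial_subset hM hx).1
  exact norm_pos_iff.1 ((Real.exp_pos _).trans_le h)

lemma hasCompactSupport_logRadial {n : ℕ} {G : ℝ → ℝ} {M : ℝ}
    (hM : ∀ t, M < |t| → G t = 0) : HasCompactSupport (logRadial (n := n) G) := by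
  refine HasCompactSupport.intro (isCompact_closedBall 0 (Real.exp M)) fun x hx => ?_
  by_contra h
  exact hx (mem_closedBall_zero_iff.2 (norm_mem_Icc_of_logRadial_ne_zero hM h).2)

lemma contDiff_logRadial {n : ℕ} {G : ℝ → ℝ} {M : ℝ} (hG : ContDiff ℝ (⊤ : ℕ∞) G)
    (hM : ∀ t, M < |t| → G t = 0) : ContDiff ℝ (⊤ : ℕ∞) (logRadial (n := n) G) := by
  refine contDiff_iff_contDiffAt.2 fun x => ?_
  by_cases hx : x ∈ tsupport (logRadial G)
  swap
  · exact contDiffAt_const.congr_of_eventuallyEq (notMem_tsupport_iff_eventuallyEq.1 hx)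
  have hx0 : x ≠ 0 := tsupport_logRadial_subset_ne hM hx
  refine ContDiffAt.congr_of_eventuallyEq ?_ (logRadial_eventuallyEq G hx0)
  refine hG.contDiffAt.comp x (contDiffAt_const.mul (ContDiffAt.log ?_ ?_))
  · exact (contDiff_norm_sq ℝ).contDiffAt
  · exact pow_ne_zero 2 (norm_ne_zero_iff.2 hx0)

lemma norm_gradient_logRadial_sq {n : ℕ} {G : ℝ → ℝ} {x : Euc n} (hx : x ≠ 0) {g : ℝ}
    (hG : HasDerivAt G g (Real.log ‖x‖)) :
    ‖gradient (logRadial G) x‖ ^ 2 = g ^ 2 / ‖x‖ ^ 2 := by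
  have hn : ‖x‖ ≠ 0 := norm_ne_zero_iff.2 hx
  rw [log_norm_eq_half_log_norm_sq] at hG
  have h1 := ((hasStrictFDerivAt_norm_sq x).hasFDerivAt.log (pow_ne_zero 2 hn)).const_mul
    (1 / 2 : ℝ)
  have h2 := (hG.comp_hasFDerivAt x h1).congr_of_eventuallyEq (logRadial_eventuallyEq G hx)
  have h3 : HasGradientAt (logRadial G) ((g / ‖x‖ ^ 2) • x) x := by
    rw [hasGradientAt_iff_hasFDerivAt]
    convert! h2 using 1
    ext y
    simp
    field_simp
  rw [h3.gradient, norm_smul, mul_pow, Real.norm_eq_abs, sq_abs]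
  field_simp

lemma continuous_norm_gradient_sq {n : ℕ} {φ : Euc n → ℝ} (hφ : ContDiff ℝ (⊤ : ℕ∞) φ) :
    Continuous fun x => ‖gradient φ x‖ ^ 2 := by
  have h : (fun x => ‖gradient φ x‖ ^ 2) = fun x => ‖fderiv ℝ φ x‖ ^ 2 := by
    ext x
    rw [gradient, LinearIsometryEquiv.norm_map]
  rw [h]
  exact (hφ.continuous_fderiv (by simp)).norm.pow 2

lemma integrable_norm_gradient_sq {n : ℕ} {φ : Euc n → ℝ} (hφ : ContDiff ℝ (⊤ : ℕ∞) φ)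
    (hc : HasCompactSupport φ) : Integrable fun x => ‖gradient φ x‖ ^ 2 := by
  refine (continuous_norm_gradient_sq hφ).integrable_of_hasCompactSupport ?_
  refine (hc.fderiv ℝ).mono fun x hx => ?_
  contrapose! hx
  simp [gradient, Function.notMem_support.1 hx]

lemma integrable_mul_sq {n : ℕ} {W φ : Euc n → ℝ} (hW : ContinuousOn W {x | x ≠ 0})
    (hφ : Continuous φ) (hc : HasCompactSupport φ) (hs : tsupport φ ⊆ {x | x ≠ 0}) :
    Integrable fun x => W x * φ x ^ 2 := by
  have hsub : tsupport (fun x => W x * φ x ^ 2) ⊆ tsupport φ := by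
    refine closure_mono fun x hx => ?_
    contrapose! hx
    simp [Function.notMem_support.1 hx]
  refine Continuous.integrable_of_hasCompactSupport ?_
    (hc.of_isClosed_subset (isClosed_tsupport _) hsub)
  exact (hW.mul (hφ.pow 2).continuousOn).continuous_of_tsupport_subset isOpen_ne
    (hsub.trans hs)

lemma integral_Ioi_zero_eq_integral_exp (f : ℝ → ℝ) :
    ∫ r in Ioi (0 : ℝ), f r = ∫ t, Real.exp t * f (Real.exp t) := by
  have h := integral_image_eq_integral_abs_deriv_smul (s := univ) (f := Real.exp)
    (f' := Real.exp) MeasurableSet.univ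
    (fun x _ => (Real.hasDerivAt_exp x).hasDerivWithinAt) Real.exp_injective.injOn f
  simpa [Real.range_exp] using h

lemma integral_exp_mul_comp_log_norm {n : ℕ} (hn : 1 ≤ n) (H : ℝ → ℝ) :
    ∫ x : Euc n, Real.exp (-n * Real.log ‖x‖) * H (Real.log ‖x‖) =
      n * volume.real (ball (0 : Euc n) 1) * ∫ t, H t := by
  have : Nonempty (Fin n) := ⟨⟨0, hn⟩⟩
  rw [integral_fun_norm_addHaar (volume : Measure (Euc n))
    (fun r => Real.exp (-n * Real.log r) * H (Real.log r)), integral_Ioi_zero_eq_integral_exp]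
  simp only [finrank_euclideanSpace_fin, nsmul_eq_mul, smul_eq_mul, Real.log_exp, ← mul_assoc]
  congr 1
  refine integral_congr_ae (.of_forall fun t => ?_)
  dsimp only
  rw [← Real.exp_nat_mul, ← Real.exp_add, ← Real.exp_add]
  push_cast [Nat.cast_sub hn]
  rw [show t + (n - 1) * t + -n * t = 0 by ring, Real.exp_zero, one_mul]

/-- The ground state representation of the Hardy functional on radial functions. -/
lemma integral_gradient_sub_hardy {n : ℕ} (hn : 1 ≤ n) {ψ : ℝ → ℝ}
    (hψ : ContDiff ℝ (⊤ : ℕ∞) ψ) (hc : HasCompactSupport ψ) :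
    ∫ x : Euc n,
      (‖gradient (logRadial fun t => Real.exp (-(((n : ℝ) - 2) / 2) * t) * ψ t) x‖ ^ 2 -
      (((n : ℝ) - 2) / 2) ^ 2 / ‖x‖ ^ 2 *
        logRadial (fun t => Real.exp (-(((n : ℝ) - 2) / 2) * t) * ψ t) x ^ 2) =
      n * volume.real (ball (0 : Euc n) 1) * ∫ t, deriv ψ t ^ 2 := by
  have : Nonempty (Fin n) := ⟨⟨0, hn⟩⟩
  set a : ℝ := ((n : ℝ) - 2) / 2 with ha
  have hd : ∀ t, HasDerivAt ψ (deriv ψ t) t := fun t =>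
    (hψ.differentiable (by simp) t).hasDerivAt
  have hdc : Continuous (deriv ψ) := hψ.continuous_deriv (by simp)
  have hi1 : Integrable fun t => deriv ψ t ^ 2 := by
    refine (hdc.pow 2).integrable_of_hasCompactSupport (hc.deriv.mono fun t ht => ?_)
    contrapose! ht
    simp [Function.notMem_support.1 ht]
  have hi2 : Integrable fun t => 2 * ψ t * deriv ψ t := by
    refine ((hψ.continuous.const_mul 2).mul hdc).integrable_of_hasCompactSupport
      (hc.deriv.mono fun t ht => ?_)
    contrapose! ht
    simp [Function.notMem_support.1 ht]
  have hi3 : Integrable fun t => ψ t ^ 2 := by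
    refine (hψ.continuous.pow 2).integrable_of_hasCompactSupport (hc.mono fun t ht => ?_)
    contrapose! ht
    simp [Function.notMem_support.1 ht]
  have hzero : ∫ t, 2 * ψ t * deriv ψ t = 0 := by
    refine integral_eq_zero_of_hasDerivAt_of_integrable (f := fun t => ψ t ^ 2)
      (fun t => ?_) hi2 hi3
    simpa using (hd t).fun_pow 2
  have hH : ∫ t, (deriv ψ t ^ 2 - a * (2 * ψ t * deriv ψ t)) = ∫ t, deriv ψ t ^ 2 := by
    rw [integral_sub hi1 (hi2.const_mul a), integral_const_mul, hzero]
    ring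
  rw [← hH, ← integral_exp_mul_comp_log_norm hn]
  refine integral_congr_ae ?_
  filter_upwards [compl_mem_ae_iff.2 (measure_singleton (0 : Euc n))] with x hx
  have hx0 : x ≠ 0 := hx
  have hpos := norm_pos_iff.2 hx0
  have hG : HasDerivAt (fun t => Real.exp (-a * t) * ψ t)
      (Real.exp (-a * Real.log ‖x‖) * (deriv ψ (Real.log ‖x‖) - a * ψ (Real.log ‖x‖)))
      (Real.log ‖x‖) := by
    have h1 : HasDerivAt (fun t => Real.exp (-a * t)) (Real.exp (-a * Real.log ‖x‖) * -a)
      (Real.log ‖x‖) := by simpa using ((hasDerivAt_id (Real.log ‖x‖)).const_mul (-a)).exp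
    convert! h1.mul (hd _) using 1
    ring
  rw [norm_gradient_logRadial_sq hx0 hG, logRadial_of_ne _ hx0]
  have hexp : Real.exp (-n * Real.log ‖x‖) = Real.exp (-a * Real.log ‖x‖) ^ 2 / ‖x‖ ^ 2 := by
    rw [eq_div_iff (by positivity)]
    nth_rw 2 [← Real.exp_log hpos]
    rw [← Real.exp_nat_mul, ← Real.exp_nat_mul, ← Real.exp_add, ha]
    congr 1
    push_cast
    ring
  rw [hexp]
  ring

/-- Rescaled cutoffs equal to one on large intervals have small Dirichlet energy. -/
lemma exists_cutoff_small_energy (R₀ : ℝ) {ε : ℝ} (hε : 0 < ε) :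
    ∃ ψ : ℝ → ℝ, ContDiff ℝ (⊤ : ℕ∞) ψ ∧ HasCompactSupport ψ ∧
      (∀ t, |t| ≤ R₀ → ψ t = 1) ∧ ∫ t, deriv ψ t ^ 2 < ε := by
  let η : ContDiffBump (0 : ℝ) := ⟨1, 2, one_pos, one_lt_two⟩
  set K := ∫ t, deriv η t ^ 2
  obtain ⟨R, hR0, hR1, hRK⟩ : ∃ R : ℝ, 0 < R ∧ R₀ ≤ R ∧ K / ε < R :=
    ⟨max 1 (max R₀ (K / ε + 1)), by positivity, by simp, by
      have : K / ε + 1 ≤ max 1 (max R₀ (K / ε + 1)) := by simp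
      linarith⟩
  refine ⟨fun t => η (R⁻¹ * t), ?_, ?_, ?_, ?_⟩
  · exact η.contDiff.comp (contDiff_const.mul contDiff_id)
  · exact η.hasCompactSupport.comp_homeomorph (Homeomorph.mulLeft₀ R⁻¹ (inv_ne_zero hR0.ne'))
  · intro t ht
    refine η.one_of_mem_closedBall ?_
    rw [mem_closedBall_zero_iff, Real.norm_eq_abs, abs_mul, abs_of_pos (inv_pos.2 hR0),
      inv_mul_le_iff₀ hR0]
    change |t| ≤ R * 1
    linarith
  · have hd : ∀ t, deriv (fun t => η (R⁻¹ * t)) t ^ 2 = (R⁻¹) ^ 2 * deriv η (R⁻¹ * t) ^ 2 := by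
      intro t
      rw [deriv_comp_mul_left, smul_eq_mul, mul_pow]
    simp_rw [hd]
    rw [integral_const_mul,
      Measure.integral_comp_inv_mul_left (fun t => deriv η t ^ 2), abs_of_pos hR0, smul_eq_mul]
    change R⁻¹ ^ 2 * (R * K) < ε
    rw [div_lt_iff₀ hε] at hRK
    rw [show R⁻¹ ^ 2 * (R * K) = K / R by field_simp, div_lt_iff₀ hR0]
    linarith

lemma exists_eq_zero_of_lt_abs_of_hasCompactSupport {ψ : ℝ → ℝ} (hc : HasCompactSupport ψ) :
    ∃ M : ℝ, ∀ t, M < |t| → ψ t = 0 := by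
  obtain ⟨M, hM⟩ := hc.isCompact.isBounded.exists_norm_le
  refine ⟨M, fun t ht => image_eq_zero_of_notMem_tsupport fun h => ?_⟩
  exact absurd (hM t h) (not_le.2 ht)

theorem stmt7 {n : ℕ} (hn : 3 ≤ n) (V : Euc n → ℝ)
    (hVc : ContinuousOn V {x : Euc n | x ≠ 0})
    (hV : ∀ x : Euc n, x ≠ 0 → (((n : ℝ) - 2) / 2) ^ 2 / ‖x‖ ^ 2 ≤ V x)
    (x₀ : Euc n) (hx₀ : x₀ ≠ 0)
    (hV₀ : (((n : ℝ) - 2) / 2) ^ 2 / ‖x₀‖ ^ 2 < V x₀) :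
    ∃ φ : Euc n → ℝ, ContDiff ℝ (⊤ : ℕ∞) φ ∧ HasCompactSupport φ ∧
      tsupport φ ⊆ {x : Euc n | x ≠ 0} ∧
      ∫ x in {x : Euc n | x ≠ 0}, ‖gradient φ x‖ ^ 2 <
        ∫ x in {x : Euc n | x ≠ 0}, V x * φ x ^ 2 := by
  have : Nonempty (Fin n) := ⟨⟨0, by omega⟩⟩
  set a : ℝ := ((n : ℝ) - 2) / 2 with ha
  have hset : volume.restrict {x : Euc n | x ≠ 0} = volume :=
    Measure.restrict_eq_self_of_ae_mem (compl_mem_ae_iff.2 (measure_singleton (0 : Euc n)))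
  rw [hset]
  have hHc : ContinuousOn (fun x : Euc n => a ^ 2 / ‖x‖ ^ 2) {x : Euc n | x ≠ 0} :=
    continuousOn_const.div (continuous_norm.pow 2).continuousOn
      fun x hx => pow_ne_zero 2 (norm_ne_zero_iff.2 hx)
  have hlog : ContinuousOn (fun x : Euc n => Real.log ‖x‖) {x : Euc n | x ≠ 0} :=
    continuous_norm.continuousOn.log fun x hx => norm_ne_zero_iff.2 hx
  set h : Euc n → ℝ := fun x => (V x - a ^ 2 / ‖x‖ ^ 2) * Real.exp (-a * Real.log ‖x‖) ^ 2
    with hh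
  have hhc : ContinuousOn h {x : Euc n | x ≠ 0} :=
    (hVc.sub hHc).mul ((Real.continuous_exp.comp_continuousOn
      (continuousOn_const.mul hlog)).pow 2)
  have hnhds : {x : Euc n | x ≠ 0} ∈ 𝓝 x₀ := isOpen_ne.mem_nhds hx₀
  have hx₀h : 0 < h x₀ := mul_pos (sub_pos.2 hV₀) (by positivity)
  obtain ⟨c, hc0, hc⟩ := exists_between hx₀h
  set R₀ := |Real.log ‖x₀‖| + 1 with hR₀
  have hev : ∀ᶠ x in 𝓝 x₀, x ≠ 0 ∧ c < h x ∧ |Real.log ‖x‖| < R₀ :=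
    (isOpen_ne.eventually_mem hx₀).and <| ((hhc.continuousAt hnhds).eventually_const_lt hc).and <|
      (hlog.continuousAt hnhds).abs.eventually_lt_const (lt_add_one _)
  obtain ⟨ρ, hρ, hball⟩ := Metric.eventually_nhds_iff_ball.1 hev
  set δ := c * volume.real (ball x₀ ρ) with hδ
  have hδ0 : 0 < δ := mul_pos hc0
    (ENNReal.toReal_pos (measure_ball_pos volume x₀ hρ).ne' measure_ball_lt_top.ne)
  set A : ℝ := n * volume.real (ball (0 : Euc n) 1) with hA
  have hA0 : 0 < A := mul_pos (by exact_mod_cast (by omega : 0 < n))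
    (ENNReal.toReal_pos (measure_ball_pos volume _ one_pos).ne' measure_ball_lt_top.ne)
  obtain ⟨ψ, hψ, hψc, hψ1, hψe⟩ := exists_cutoff_small_energy R₀ (div_pos hδ0 hA0)
  obtain ⟨M, hM⟩ := exists_eq_zero_of_lt_abs_of_hasCompactSupport hψc
  set G : ℝ → ℝ := fun t => Real.exp (-a * t) * ψ t with hGdef
  have hG : ContDiff ℝ (⊤ : ℕ∞) G := (contDiff_const.mul contDiff_id).exp.mul hψ
  have hGM : ∀ t, M < |t| → G t = 0 := fun t ht => by simp [hGdef, hM t ht]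
  have hφ := contDiff_logRadial (n := n) hG hGM
  have hφc := hasCompactSupport_logRadial (n := n) hGM
  have hφs := tsupport_logRadial_subset_ne (n := n) hGM
  refine ⟨logRadial G, hφ, hφc, hφs, ?_⟩
  have hi1 := integrable_norm_gradient_sq hφ hφc
  have hi2 := integrable_mul_sq hVc hφ.continuous hφc hφs
  have hi3 := integrable_mul_sq hHc hφ.continuous hφc hφs
  have hi4 := integrable_mul_sq (hVc.sub hHc) hφ.continuous hφc hφs
  have henergy := integral_gradient_sub_hardy (by omega : 1 ≤ n) hψ hψc
  rw [integral_sub hi1 hi3] at henergy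
  have hgap : δ ≤ ∫ x : Euc n, (V x - a ^ 2 / ‖x‖ ^ 2) * logRadial G x ^ 2 := by
    have hnonneg : ∀ x : Euc n, 0 ≤ (V x - a ^ 2 / ‖x‖ ^ 2) * logRadial G x ^ 2 := by
      intro x
      by_cases hx : x = 0
      · simp [hx, logRadial]
      · exact mul_nonneg (sub_nonneg.2 (hV x hx)) (sq_nonneg _)
    refine le_trans ?_ (setIntegral_le_integral (s := ball x₀ ρ) hi4 (.of_forall hnonneg))
    have hconst : δ = ∫ _ in ball x₀ ρ, c := by
      rw [setIntegral_const, smul_eq_mul, mul_comm]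
    rw [hconst]
    refine setIntegral_mono_on (integrableOn_const measure_ball_lt_top.ne) hi4.integrableOn
      measurableSet_ball fun x hx => ?_
    obtain ⟨hx0, hcx, hRx⟩ := hball x hx
    have hval : logRadial G x = Real.exp (-a * Real.log ‖x‖) := by
      rw [logRadial_of_ne G hx0]
      simp [hGdef, hψ1 _ hRx.le]
    change c ≤ (V x - a ^ 2 / ‖x‖ ^ 2) * logRadial G x ^ 2
    rw [hval]
    exact hcx.le
  simp_rw [sub_mul] at hgap
  rw [integral_sub hi2 hi3] at hgap
  rw [lt_div_iff₀ hA0, mul_comm] at hψe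
  linarith
end
end

section
/- For every λ > 1 the operator −Δ − λ C_H |x|^{−2} is supercritical near both ends of ℝⁿ \ {0}: (i) for every R > 0 there is no twice continuously differentiable function u that is positive on {x ∈ ℝⁿ : |x| > R} and satisfies −Δu(x) ≥ λ C_H |x|^{−2} u(x) for all |x| > R; and (ii) for every r > 0 there is no twice continuously differentiable function u that is positive on {x ∈ ℝⁿ : 0 < |x| < r} and satisfies −Δu(x) ≥ λ C_H |x|^{−2} u(x) for all 0 < |x| < r. -/
open MeasureTheory Finset

noncomputable section

/-- The Euclidean Laplacian `Δu(x) = ∑ᵢ ∂ᵢ∂ᵢ u (x)`. -/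
def lap {n : ℕ} (u : Euc n → ℝ) (x : Euc n) : ℝ := ∑ i, pd2 i i u x

/-- Second-order necessary condition for a local minimum on the real line. -/
lemma IsLocalMin.second_deriv_nonneg {f f' : ℝ → ℝ} {a x : ℝ} (hmin : IsLocalMin f x)
    (hf : ∀ᶠ s in nhds x, HasDerivAt f (f' s) s) (hf' : HasDerivAt f' a x) : 0 ≤ a := by
  by_contra! ha
  have hd : deriv f =ᶠ[nhds x] f' := hf.mono fun s hs => hs.deriv
  have hdd : deriv (deriv f) x = a := by rw [hd.deriv_eq, hf'.deriv]
  have hmax : IsLocalMax f x :=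
    isLocalMax_of_deriv_deriv_neg (by rwa [hdd]) hmin.deriv_eq_zero
      hf.self_of_nhds.continuousAt
  have hc : f =ᶠ[nhds x] fun _ => f x := by
    filter_upwards [hmin, hmax] with s h1 h2 using le_antisymm h2 h1
  have h0 : deriv (deriv f) x = 0 := by
    rw [hc.deriv.deriv_eq]; simp
  linarith

lemma hasDerivAt_line {n : ℕ} (x e : Euc n) (s : ℝ) :
    HasDerivAt (fun s : ℝ => x + s • e) e s := by
  simpa using ((hasDerivAt_id s).smul_const e).const_add x

/-- First and second derivatives of a `C²` function along a coordinate line. -/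
lemma ContDiffAt.hasDerivAt_coordinate_line {n : ℕ} {u : Euc n → ℝ} {x : Euc n}
    (hu : ContDiffAt ℝ 2 u x) (i : Fin n) :
    (∀ᶠ s in nhds (0 : ℝ), HasDerivAt (fun s : ℝ => u (x + s • EuclideanSpace.single i 1))
        (pd i u (x + s • EuclideanSpace.single i 1)) s) ∧
      HasDerivAt (fun s : ℝ => pd i u (x + s • EuclideanSpace.single i 1)) (pd2 i i u x) 0 := by
  set e : Euc n := EuclideanSpace.single i 1 with he
  have hline : Filter.Tendsto (fun s : ℝ => x + s • e) (nhds 0) (nhds x) := by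
    simpa [ContinuousAt] using (hasDerivAt_line x e 0).continuousAt
  constructor
  · have hev : ∀ᶠ y in nhds x, ContDiffAt ℝ 2 u y := hu.eventually (by simp)
    filter_upwards [hline.eventually hev] with s hs
    exact (hs.differentiableAt (by norm_num)).hasFDerivAt.comp_hasDerivAt s
      (hasDerivAt_line x e s)
  · have h1 : DifferentiableAt ℝ (fderiv ℝ u) x :=
      (hu.fderiv_right (m := 1) (by norm_num)).differentiableAt (by norm_num)
    have h2 : DifferentiableAt ℝ (fun y => fderiv ℝ u y e) x :=
      h1.clm_apply (differentiableAt_const e)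
    exact h2.hasFDerivAt.comp_hasDerivAt_of_eq 0 (hasDerivAt_line x e 0) (by simp)

/-- The radial profile `e^{-mτ} sin (w (τ - τ₀))` in the variable `τ = log ‖x‖²`. -/
def oscProfile (m w τ₀ τ : ℝ) : ℝ := Real.exp (-(m * τ)) * Real.sin (w * (τ - τ₀))

def oscProfileDeriv (m w τ₀ τ : ℝ) : ℝ :=
  Real.exp (-(m * τ)) * (w * Real.cos (w * (τ - τ₀)) - m * Real.sin (w * (τ - τ₀)))

lemma hasDerivAt_oscProfile (m w τ₀ τ : ℝ) :
    HasDerivAt (oscProfile m w τ₀) (oscProfileDeriv m w τ₀ τ) τ := by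
  have h1 : HasDerivAt (fun τ => w * (τ - τ₀)) w τ := by
    simpa using ((hasDerivAt_id τ).sub_const τ₀).const_mul w
  have h2 : HasDerivAt (fun τ => -(m * τ)) (-m) τ := by
    simpa using (hasDerivAt_const_mul (x := τ) m).fun_neg
  refine (h2.exp.mul h1.sin).congr_deriv ?_
  unfold oscProfileDeriv
  ring

lemma hasDerivAt_oscProfileDeriv (m w τ₀ τ : ℝ) :
    HasDerivAt (oscProfileDeriv m w τ₀)
      (-(2 * m) * oscProfileDeriv m w τ₀ τ - (w ^ 2 + m ^ 2) * oscProfile m w τ₀ τ) τ := by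
  have h1 : HasDerivAt (fun τ => w * (τ - τ₀)) w τ := by
    simpa using ((hasDerivAt_id τ).sub_const τ₀).const_mul w
  have h2 : HasDerivAt (fun τ => -(m * τ)) (-m) τ := by
    simpa using (hasDerivAt_const_mul (x := τ) m).fun_neg
  refine (h2.exp.mul ((h1.cos.const_mul w).sub (h1.sin.const_mul m))).congr_deriv ?_
  simp only [oscProfileDeriv, oscProfile, Pi.sub_apply]
  ring

lemma norm_sq_coordinate_line {n : ℕ} (x : Euc n) (i : Fin n) (s : ℝ) :
    ‖x + s • EuclideanSpace.single i (1 : ℝ)‖ ^ 2 = ‖x‖ ^ 2 + 2 * s * x i + s ^ 2 := by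
  rw [norm_add_sq_real, inner_smul_right, EuclideanSpace.inner_single_right, norm_smul]
  simp
  ring

/-- First and second derivatives along a coordinate line of a radial function `h (log ‖x‖²)`. -/
lemma hasDerivAt_radial_coordinate_line {n : ℕ} {h h' h'' : ℝ → ℝ}
    (hh : ∀ τ, HasDerivAt h (h' τ) τ) (hh' : ∀ τ, HasDerivAt h' (h'' τ) τ)
    {x : Euc n} (hx : x ≠ 0) (i : Fin n) :
    ∃ g' : ℝ → ℝ,
      (∀ᶠ s in nhds (0 : ℝ), HasDerivAt
        (fun s : ℝ => h (Real.log (‖x + s • EuclideanSpace.single i (1 : ℝ)‖ ^ 2))) (g' s) s) ∧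
      HasDerivAt g' (h'' (Real.log (‖x‖ ^ 2)) * (2 * x i / ‖x‖ ^ 2) ^ 2 +
        h' (Real.log (‖x‖ ^ 2)) * (2 / ‖x‖ ^ 2 - (2 * x i / ‖x‖ ^ 2) ^ 2)) 0 := by
  have hρ : 0 < ‖x‖ ^ 2 := by positivity
  simp_rw [norm_sq_coordinate_line]
  set ρ := ‖x‖ ^ 2
  set b := x i
  have hq (s : ℝ) : HasDerivAt (fun s : ℝ => ρ + 2 * s * b + s ^ 2) (2 * b + 2 * s) s := by
    refine (((((hasDerivAt_id s).const_mul 2).mul_const b).const_add ρ).add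
      ((hasDerivAt_id s).pow 2)).congr_deriv ?_
    simp
  have hlog (s : ℝ) (hs : ρ + 2 * s * b + s ^ 2 ≠ 0) :
      HasDerivAt (fun s : ℝ => Real.log (ρ + 2 * s * b + s ^ 2))
        ((2 * b + 2 * s) / (ρ + 2 * s * b + s ^ 2)) s := (hq s).log hs
  refine ⟨fun s => h' (Real.log (ρ + 2 * s * b + s ^ 2)) *
    ((2 * b + 2 * s) / (ρ + 2 * s * b + s ^ 2)), ?_, ?_⟩
  · have hev : ∀ᶠ s in nhds (0 : ℝ), ρ + 2 * s * b + s ^ 2 ≠ 0 :=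
      (hq 0).continuousAt.eventually_ne (by simpa using hρ.ne')
    filter_upwards [hev] with s hs
    exact (hh _).comp s (hlog s hs)
  · have h0 : ρ + 2 * 0 * b + 0 ^ 2 ≠ 0 := by simpa using hρ.ne'
    have hlin : HasDerivAt (fun s : ℝ => 2 * b + 2 * s) 2 0 := by
      simpa using ((hasDerivAt_id (0 : ℝ)).const_mul 2).const_add (2 * b)
    refine (((hh' _).comp (0 : ℝ) (hlog 0 h0)).mul (hlin.div (hq 0) h0)).congr_deriv ?_
    simp
    field_simp

/-- A positive multiple of `u` cannot touch a strict radial subsolution from above on an annulus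
`exp τ₀ ≤ ‖x‖² ≤ exp (τ₀ + π / w)`: hence there is no positive supersolution there. -/
lemma no_positive_supersolution_on_annulus {n : ℕ} (hn : 3 ≤ n) {lam w τ₀ : ℝ} (hw : 0 < w)
    (hlam : ((n : ℝ) - 2) ^ 2 / 4 + 4 * w ^ 2 < lam * (((n : ℝ) - 2) / 2) ^ 2)
    {u : Euc n → ℝ}
    (hu : ∀ x : Euc n, Real.exp τ₀ ≤ ‖x‖ ^ 2 → ‖x‖ ^ 2 ≤ Real.exp (τ₀ + Real.pi / w) →
      ContDiffAt ℝ 2 u x ∧ 0 < u x ∧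
        lam * ((((n : ℝ) - 2) / 2) ^ 2 / ‖x‖ ^ 2) * u x ≤ -lap u x) : False := by
  set m : ℝ := ((n : ℝ) - 2) / 4 with hm
  set T := Real.pi / w with hT
  have hTpos : 0 < T := by positivity
  have hwT : w * T = Real.pi := by rw [hT]; field_simp
  set K : Set (Euc n) := {x | Real.exp τ₀ ≤ ‖x‖ ^ 2 ∧ ‖x‖ ^ 2 ≤ Real.exp (τ₀ + T)} with hK
  set φ : Euc n → ℝ := fun x => oscProfile m w τ₀ (Real.log (‖x‖ ^ 2)) with hφ
  have hne : ∀ x ∈ K, 0 < ‖x‖ ^ 2 := fun x hx => (Real.exp_pos _).trans_le hx.1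
  have hKc : IsCompact K := by
    refine Metric.isCompact_of_isClosed_isBounded ?_ ?_
    · have hc : Continuous fun x : Euc n => ‖x‖ ^ 2 := by fun_prop
      exact (isClosed_le continuous_const hc).inter (isClosed_le hc continuous_const)
    · refine isBounded_iff_forall_norm_le.2 ⟨Real.exp (τ₀ + T) + 1, fun x hx => ?_⟩
      nlinarith [hx.2, sq_nonneg (‖x‖ - 1), norm_nonneg x]
  let i₀ : Fin n := ⟨0, by omega⟩
  set x₁ : Euc n := EuclideanSpace.single i₀ (Real.exp ((τ₀ + T / 2) / 2)) with hx₁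
  have hx₁n : ‖x₁‖ ^ 2 = Real.exp (τ₀ + T / 2) := by
    rw [hx₁, PiLp.norm_single, Real.norm_eq_abs, sq_abs, ← Real.exp_nat_mul]
    congr 1
    push_cast
    ring
  have hx₁K : x₁ ∈ K := by
    simp only [hK, Set.mem_ofPred_eq, hx₁n, Real.exp_le_exp]
    constructor <;> linarith
  have hφ₁ : 0 < φ x₁ := by
    simp only [hφ, hx₁n, Real.log_exp, oscProfile]
    have h2 : w * (τ₀ + T / 2 - τ₀) = Real.pi / 2 := by linarith
    rw [h2, Real.sin_pi_div_two]
    positivity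
  have hcont : ContinuousOn (fun x => φ x / u x) K := by
    intro x hx
    have hux := hu x hx.1 hx.2
    have hlog : ContinuousAt (fun x : Euc n => Real.log (‖x‖ ^ 2)) x :=
      ContinuousAt.log (by fun_prop) (hne x hx).ne'
    have hφx : ContinuousAt φ x :=
      ContinuousAt.comp (f := fun x : Euc n => Real.log (‖x‖ ^ 2))
        (hasDerivAt_oscProfile m w τ₀ _).continuousAt hlog
    exact (hφx.div hux.1.continuousAt hux.2.1.ne').continuousWithinAt
  obtain ⟨x₀, hx₀, hmax⟩ := hKc.exists_isMaxOn ⟨x₁, hx₁K⟩ hcont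
  obtain ⟨hu₀, hupos, hineq⟩ := hu x₀ hx₀.1 hx₀.2
  have hρ := hne x₀ hx₀
  set t := φ x₀ / u x₀ with ht
  have htpos : 0 < t := (div_pos hφ₁ (hu x₁ hx₁K.1 hx₁K.2).2.1).trans_le (hmax hx₁K)
  have htu : t * u x₀ = φ x₀ := div_mul_cancel₀ _ hupos.ne'
  have hφ₀ : 0 < φ x₀ := by rw [← htu]; positivity
  have hsin : Real.sin (w * (Real.log (‖x₀‖ ^ 2) - τ₀)) ≠ 0 := by
    intro h
    simp only [hφ, oscProfile, h, mul_zero, lt_irrefl] at hφ₀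
  have hlo : Real.exp τ₀ < ‖x₀‖ ^ 2 := by
    refine lt_of_le_of_ne hx₀.1 fun h => hsin ?_
    rw [← h, Real.log_exp]
    simp
  have hhi : ‖x₀‖ ^ 2 < Real.exp (τ₀ + T) := by
    refine lt_of_le_of_ne hx₀.2 fun h => hsin ?_
    rw [h, Real.log_exp, add_sub_cancel_left, hwT, Real.sin_pi]
  have hnhds : K ∈ nhds x₀ := by
    have hc : ContinuousAt (fun x : Euc n => ‖x‖ ^ 2) x₀ := by fun_prop
    filter_upwards [hc.eventually_const_lt hlo, hc.eventually_lt_const hhi] with x h1 h2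
      using ⟨h1.le, h2.le⟩
  set A := oscProfileDeriv m w τ₀ (Real.log (‖x₀‖ ^ 2)) with hA
  set ρ := ‖x₀‖ ^ 2 with hρdef
  have hsecond (i : Fin n) :
      (-(2 * m) * A - (w ^ 2 + m ^ 2) * φ x₀) * (2 * x₀ i / ρ) ^ 2 +
        A * (2 / ρ - (2 * x₀ i / ρ) ^ 2) ≤ t * pd2 i i u x₀ := by
    obtain ⟨hu1, hu2⟩ := hu₀.hasDerivAt_coordinate_line i
    obtain ⟨g', hg1, hg2⟩ := hasDerivAt_radial_coordinate_line
      (hasDerivAt_oscProfile m w τ₀) (hasDerivAt_oscProfileDeriv m w τ₀)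
      (x := x₀) (by rintro rfl; simp [hρdef] at hρ) i
    have hline : Filter.Tendsto (fun s : ℝ => x₀ + s • EuclideanSpace.single i (1 : ℝ))
        (nhds 0) (nhds x₀) := by
      simpa [ContinuousAt] using
        (hasDerivAt_line x₀ (EuclideanSpace.single i (1 : ℝ)) 0).continuousAt
    have hmin : IsLocalMin (fun s : ℝ => t * u (x₀ + s • EuclideanSpace.single i (1 : ℝ)) -
        φ (x₀ + s • EuclideanSpace.single i (1 : ℝ))) 0 := by
      filter_upwards [hline hnhds] with s hs
      have h1 := hmax hs
      have h2 := (hu _ hs.1 hs.2).2.1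
      have h3 := (div_le_iff₀ h2).1 h1
      simp only [zero_smul, add_zero, htu, sub_self]
      linarith
    have hder := hmin.second_deriv_nonneg
      (f' := fun s => t * pd i u (x₀ + s • EuclideanSpace.single i (1 : ℝ)) - g' s)
      (by filter_upwards [hu1, hg1] with s h1 h2 using (h1.const_mul t).sub h2)
      ((hu2.const_mul t).sub hg2)
    linarith
  have hsum := Finset.sum_le_sum fun i (_ : i ∈ Finset.univ) => hsecond i
  have hsq : ∑ i, x₀ i ^ 2 = ρ := by
    rw [hρdef, EuclideanSpace.norm_sq_eq]
    simp
  have hcoord : ∑ i, (2 * x₀ i / ρ) ^ 2 = 4 / ρ := by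
    simp_rw [div_pow, mul_pow]
    rw [← Finset.sum_div, ← Finset.mul_sum, hsq]
    field_simp
    norm_num
  rw [Finset.sum_add_distrib, ← Finset.mul_sum, ← Finset.mul_sum, Finset.sum_sub_distrib,
    hcoord, ← Finset.mul_sum] at hsum
  simp only [Finset.sum_const, Finset.card_univ, Fintype.card_fin, nsmul_eq_mul] at hsum
  change _ ≤ t * lap u x₀ at hsum
  have hlhs : (-(2 * m) * A - (w ^ 2 + m ^ 2) * φ x₀) * (4 / ρ) + A * (n * (2 / ρ) - 4 / ρ)
      = -(4 * (w ^ 2 + m ^ 2) * φ x₀ / ρ) := by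
    rw [hm]
    field_simp
    ring
  rw [hlhs] at hsum
  have hsup : lam * (((n : ℝ) - 2) / 2) ^ 2 * φ x₀ / ρ ≤ -(t * lap u x₀) := by
    have h1 := mul_le_mul_of_nonneg_left hineq htpos.le
    rw [← htu]
    calc _ = t * (lam * ((((n : ℝ) - 2) / 2) ^ 2 / ρ) * u x₀) := by ring
      _ ≤ t * -lap u x₀ := h1
      _ = _ := by ring
  have hstrict : 4 * (w ^ 2 + m ^ 2) * φ x₀ / ρ < lam * (((n : ℝ) - 2) / 2) ^ 2 * φ x₀ / ρ := by
    have : 4 * (w ^ 2 + m ^ 2) < lam * (((n : ℝ) - 2) / 2) ^ 2 := by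
      rw [hm]
      linarith
    gcongr
  linarith

theorem stmt8 {n : ℕ} (hn : 3 ≤ n) (lam : ℝ) (hlam : 1 < lam) :
    (∀ R : ℝ, 0 < R →
      ¬ ∃ u : Euc n → ℝ, ContDiffOn ℝ 2 u {x : Euc n | R < ‖x‖} ∧
        (∀ x : Euc n, R < ‖x‖ → 0 < u x) ∧
        (∀ x : Euc n, R < ‖x‖ →
          lam * ((((n : ℝ) - 2) / 2) ^ 2 / ‖x‖ ^ 2) * u x ≤ -lap u x)) ∧
    (∀ r : ℝ, 0 < r →
      ¬ ∃ u : Euc n → ℝ, ContDiffOn ℝ 2 u {x : Euc n | 0 < ‖x‖ ∧ ‖x‖ < r} ∧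
        (∀ x : Euc n, 0 < ‖x‖ → ‖x‖ < r → 0 < u x) ∧
        (∀ x : Euc n, 0 < ‖x‖ → ‖x‖ < r →
          lam * ((((n : ℝ) - 2) / 2) ^ 2 / ‖x‖ ^ 2) * u x ≤ -lap u x)) := by
  have hn' : (3 : ℝ) ≤ n := by exact_mod_cast hn
  have hC : 0 < (((n : ℝ) - 2) / 2) ^ 2 := pow_pos (by linarith) 2
  obtain ⟨w, hw, hwlam⟩ : ∃ w : ℝ, 0 < w ∧
      ((n : ℝ) - 2) ^ 2 / 4 + 4 * w ^ 2 < lam * (((n : ℝ) - 2) / 2) ^ 2 := by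
    have hpos : 0 < (lam - 1) * (((n : ℝ) - 2) / 2) ^ 2 / 8 :=
      div_pos (mul_pos (by linarith) hC) (by norm_num)
    refine ⟨√((lam - 1) * (((n : ℝ) - 2) / 2) ^ 2 / 8), Real.sqrt_pos.2 hpos, ?_⟩
    rw [Real.sq_sqrt hpos.le]
    linarith
  constructor
  · rintro R hR ⟨u, hu, hpos, hineq⟩
    have hopen : IsOpen {x : Euc n | R < ‖x‖} := isOpen_lt continuous_const continuous_norm
    refine no_positive_supersolution_on_annulus hn (τ₀ := Real.log ((R + 1) ^ 2)) hw hwlam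
      (u := u) fun x hx _ => ?_
    rw [Real.exp_log (by positivity)] at hx
    have hxR : R < ‖x‖ := by
      have := (pow_le_pow_iff_left₀ (by positivity) (norm_nonneg x) two_ne_zero).1 hx
      linarith
    exact ⟨hu.contDiffAt (hopen.mem_nhds hxR), hpos x hxR, hineq x hxR⟩
  · rintro r hr ⟨u, hu, hpos, hineq⟩
    have hopen : IsOpen {x : Euc n | 0 < ‖x‖ ∧ ‖x‖ < r} :=
      (isOpen_lt continuous_const continuous_norm).inter
        (isOpen_lt continuous_norm continuous_const)
    refine no_positive_supersolution_on_annulus hn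
      (τ₀ := Real.log ((r / 2) ^ 2) - Real.pi / w) hw hwlam (u := u) fun x hx hx' => ?_
    rw [sub_add_cancel, Real.exp_log (by positivity)] at hx'
    have hxr : ‖x‖ < r := by
      have := (pow_le_pow_iff_left₀ (norm_nonneg x) (by positivity) two_ne_zero).1 hx'
      linarith
    have hx0 : 0 < ‖x‖ := by
      refine (norm_nonneg x).lt_of_ne fun h => ?_
      simpa [← h] using (Real.exp_pos _).trans_le hx
    exact ⟨hu.contDiffAt (hopen.mem_nhds ⟨hx0, hxr⟩), hpos x hx0 hxr, hineq x hx0 hxr⟩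
end
end

section
/- For every μ with 0 ≤ μ < 1 the Rellich-type inequality ((n−2)/2)⁴ (1−μ²)² ∫ u(x)² |x|^{−2−(n−2)μ} dx ≤ ∫ (Δu(x))² |x|^{2−(n−2)μ} dx holds for every u ∈ C_c^∞(ℝⁿ \ {0}). -/
open MeasureTheory Finset

noncomputable section

lemma hasFDerivAt_norm_rpow_of_ne_zero {n : ℕ} (s : ℝ) {x : Euc n} (hx : x ≠ 0) :
    HasFDerivAt (fun y : Euc n => ‖y‖ ^ s) ((s * ‖x‖ ^ (s - 2)) • innerSL ℝ x) x := by
  have hpos : 0 < ‖x‖ := norm_pos_iff.mpr hx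
  have h := (hasStrictFDerivAt_norm_sq x).hasFDerivAt.rpow_const (p := s / 2)
    (Or.inl (by positivity))
  have hpow (y : Euc n) (t : ℝ) : (‖y‖ ^ 2) ^ t = ‖y‖ ^ (2 * t) := by
    rw [← Real.rpow_natCast, ← Real.rpow_mul (norm_nonneg y)]; norm_num
  simp only [hpow] at h
  have hhalf : 2 * (s / 2) = s := by ring
  rw [hhalf] at h
  have hcoef : s * ‖x‖ ^ (s - 2) = s / 2 * ‖x‖ ^ (2 * (s / 2 - 1)) * 2 := by
    rw [show 2 * (s / 2 - 1) = s - 2 by ring]; ring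
  rwa [hcoef, mul_smul, ofNat_smul_eq_nsmul ℝ 2]

lemma contDiffAt_norm_rpow {n : ℕ} (s : ℝ) {x : Euc n} (hx : x ≠ 0) {k : WithTop ℕ∞} :
    ContDiffAt ℝ k (fun y : Euc n => ‖y‖ ^ s) x :=
  (contDiffAt_norm ℝ hx).rpow_const_of_ne (norm_ne_zero_iff.mpr hx)

/-- A function vanishing outside a compact set that avoids the origin is integrable as soon as it
is continuous away from the origin. -/
lemma integrable_of_continuousAt_of_ne_zero {n : ℕ} {K : Set (Euc n)} (hK : IsCompact K)
    (hK0 : K ⊆ {x | x ≠ 0}) {f : Euc n → ℝ} (hf : ∀ x ∉ K, f x = 0)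
    (hc : ∀ x ≠ 0, ContinuousAt f x) : Integrable f := by
  have hcont : Continuous f := by
    refine continuous_iff_continuousAt.mpr fun x => ?_
    by_cases hx : x = 0
    · have hxK : x ∉ K := fun h => hK0 h hx
      have h : f =ᶠ[nhds x] fun _ => 0 :=
        Filter.eventually_of_mem (hK.isClosed.isOpen_compl.mem_nhds hxK) hf
      exact continuousAt_const.congr h.symm
    · exact hc x hx
  exact hcont.integrable_of_hasCompactSupport (HasCompactSupport.intro hK hf)

/-- Directional derivatives of compactly supported `C¹` functions are integrable with vanishing
integral; here smoothness is only required away from the origin, which the support avoids. -/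
lemma integrable_fderiv_and_integral_eq_zero {n : ℕ} {K : Set (Euc n)} (hK : IsCompact K)
    (hK0 : K ⊆ {x | x ≠ 0}) {f : Euc n → ℝ} (hf : ∀ x ∉ K, f x = 0)
    (hc : ∀ x ≠ 0, ContDiffAt ℝ 1 f x) (v : Euc n) :
    Integrable (fun x => fderiv ℝ f x v) ∧ ∫ x, fderiv ℝ f x v = 0 := by
  have hzero (x : Euc n) (hx : x ∉ K) : f =ᶠ[nhds x] fun _ => 0 :=
    Filter.eventually_of_mem (hK.isClosed.isOpen_compl.mem_nhds hx) hf
  have hcd : ContDiff ℝ 1 f := by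
    refine contDiff_iff_contDiffAt.mpr fun x => ?_
    by_cases hx : x = 0
    · exact contDiffAt_const.congr_of_eventuallyEq (hzero x fun h => hK0 h hx)
    · exact hc x hx
  have hint : Integrable (fun x => fderiv ℝ f x v) := by
    refine integrable_of_continuousAt_of_ne_zero hK hK0 (fun x hx => ?_) fun x _ => ?_
    · rw [(hzero x hx).fderiv_eq]; simp
    · exact ((hcd.continuous_fderiv one_ne_zero).clm_apply continuous_const).continuousAt
  have hintf : Integrable f :=
    integrable_of_continuousAt_of_ne_zero hK hK0 hf fun x _ => hcd.continuous.continuousAt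
  refine ⟨hint, ?_⟩
  have h := integral_mul_fderiv_eq_neg_fderiv_mul_of_integrable (𝕜 := ℝ)
    (μ := (volume : Measure (Euc n))) (f := fun _ => (1 : ℝ)) (g := f) (v := v)
    (by simp) (by simpa using hint)
    (by simpa using hintf)
    (fun x _ => differentiableAt_const _) (fun x _ => hcd.differentiable one_ne_zero x)
  simpa using h

/-- The vector field whose divergence compares both sides of the Rellich inequality. -/
def rellichField {n : ℕ} (a c : ℝ) (u : Euc n → ℝ) (i : Fin n) (x : Euc n) : ℝ :=
  c * (u x ^ 2 * (x i * ‖x‖ ^ (-2 - a))) - u x * (pd i u x * ‖x‖ ^ (-a))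

lemma contDiff_pd {n : ℕ} {u : Euc n → ℝ} (hu : ContDiff ℝ (⊤ : ℕ∞) u) (i : Fin n) :
    ContDiff ℝ (⊤ : ℕ∞) (pd i u) :=
  (hu.fderiv_right (m := (⊤ : ℕ∞)) (by simp)).clm_apply contDiff_const

lemma continuous_lap {n : ℕ} {u : Euc n → ℝ} (hu : ContDiff ℝ (⊤ : ℕ∞) u) :
    Continuous (lap u) :=
  continuous_finsetSum _ fun i _ =>
    ((contDiff_pd hu i).continuous_fderiv (by simp)).clm_apply continuous_const

lemma lap_eq_zero_of_notMem_tsupport {n : ℕ} {u : Euc n → ℝ} {x : Euc n} (hx : x ∉ tsupport u) :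
    lap u x = 0 := by
  refine Finset.sum_eq_zero fun i _ => ?_
  have h : (fun y => fderiv ℝ u y (EuclideanSpace.single i 1)) =ᶠ[nhds x] fun _ => (0 : ℝ) := by
    filter_upwards [(isClosed_tsupport u).isOpen_compl.mem_nhds hx] with y hy
    rw [(notMem_tsupport_iff_eventuallyEq.mp hy).fderiv_eq]
    simp
  rw [pd2, h.fderiv_eq]
  simp

lemma contDiffAt_rellichField {n : ℕ} (a c : ℝ) {u : Euc n → ℝ} (hu : ContDiff ℝ (⊤ : ℕ∞) u)
    (i : Fin n) {x : Euc n} (hx : x ≠ 0) : ContDiffAt ℝ 1 (rellichField a c u i) x := by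
  have hu1 : ContDiffAt ℝ 1 u x := (hu.of_le (by simp)).contDiffAt
  have hp : ContDiffAt ℝ 1 (pd i u) x := ((contDiff_pd hu i).of_le (by simp)).contDiffAt
  have hi : ContDiffAt ℝ 1 (fun y : Euc n => y i) x := by fun_prop
  exact (contDiffAt_const.mul ((hu1.pow 2).mul (hi.mul (contDiffAt_norm_rpow _ hx)))).sub
    (hu1.mul (hp.mul (contDiffAt_norm_rpow _ hx)))

lemma fderiv_rellichField {n : ℕ} (a c : ℝ) {u : Euc n → ℝ} (hu : ContDiff ℝ (⊤ : ℕ∞) u)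
    (i : Fin n) {x : Euc n} (hx : x ≠ 0) :
    fderiv ℝ (rellichField a c u i) x (EuclideanSpace.single i 1) =
      c * (2 * u x * pd i u x * (x i * ‖x‖ ^ (-2 - a)) +
        u x ^ 2 * (‖x‖ ^ (-2 - a) + x i * ((-2 - a) * ‖x‖ ^ (-4 - a) * x i))) -
      (pd i u x * (pd i u x * ‖x‖ ^ (-a)) +
        u x * (pd2 i i u x * ‖x‖ ^ (-a) + pd i u x * (-a * ‖x‖ ^ (-2 - a) * x i))) := by
  have hu1 : HasFDerivAt u (fderiv ℝ u x) x := (hu.differentiable (by simp) x).hasFDerivAt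
  have hp : HasFDerivAt (pd i u) (fderiv ℝ (pd i u) x) x :=
    ((contDiff_pd hu i).differentiable (by simp) x).hasFDerivAt
  have hi : HasFDerivAt (fun y : Euc n => y i) (EuclideanSpace.proj i : Euc n →L[ℝ] ℝ) x :=
    (EuclideanSpace.proj i : Euc n →L[ℝ] ℝ).hasFDerivAt
  have h := (((hu1.pow 2).mul (hi.mul (hasFDerivAt_norm_rpow_of_ne_zero (-2 - a) hx))).const_mul
    c).sub (hu1.mul (hp.mul (hasFDerivAt_norm_rpow_of_ne_zero (-a) hx)))
  have hV : HasFDerivAt (rellichField a c u i) _ x := h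
  have hpd2 : fderiv ℝ (pd i u) x (EuclideanSpace.single i 1) = pd2 i i u x := rfl
  have hpd : fderiv ℝ u x (EuclideanSpace.single i 1) = pd i u x := rfl
  rw [hV.fderiv]
  simp [hpd2, hpd, EuclideanSpace.inner_single_right]
  ring_nf

lemma sum_fderiv_rellichField {n : ℕ} (a c : ℝ) {u : Euc n → ℝ} (hu : ContDiff ℝ (⊤ : ℕ∞) u)
    {x : Euc n} (hx : x ≠ 0) :
    ∑ i, fderiv ℝ (rellichField a c u i) x (EuclideanSpace.single i 1) =
      ‖x‖ ^ (-2 - a) * (c * (n - 2 - a) * u x ^ 2 + (2 * c + a) * u x * ∑ i, x i * pd i u x -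
        ‖x‖ ^ 2 * ∑ i, pd i u x ^ 2 - ‖x‖ ^ 2 * u x * lap u x) := by
  have hpos : 0 < ‖x‖ := norm_pos_iff.mpr hx
  have h0 : ‖x‖ ^ (-a) = ‖x‖ ^ (-2 - a) * ‖x‖ ^ 2 := by
    rw [← Real.rpow_add_natCast hpos.ne']; congr 1; push_cast; ring
  have h4 : ‖x‖ ^ (-2 - a) = ‖x‖ ^ (-4 - a) * ‖x‖ ^ 2 := by
    rw [← Real.rpow_add_natCast hpos.ne']; congr 1; push_cast; ring
  have hsum : ∑ i, x i ^ 2 = ‖x‖ ^ 2 := (EuclideanSpace.real_norm_sq_eq x).symm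
  calc _ = ∑ i, (‖x‖ ^ (-2 - a) * ((2 * c + a) * u x) * (x i * pd i u x) +
        c * u x ^ 2 * ‖x‖ ^ (-2 - a) - c * u x ^ 2 * (2 + a) * ‖x‖ ^ (-4 - a) * x i ^ 2 -
        ‖x‖ ^ (-2 - a) * ‖x‖ ^ 2 * pd i u x ^ 2 -
        ‖x‖ ^ (-2 - a) * ‖x‖ ^ 2 * u x * pd2 i i u x) := by
        refine Finset.sum_congr rfl fun i _ => ?_
        rw [fderiv_rellichField a c hu i hx, h0]
        ring
    _ = _ := by
        simp only [Finset.sum_add_distrib, Finset.sum_sub_distrib, ← Finset.mul_sum, hsum,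
          Finset.sum_const, Finset.card_univ, Fintype.card_fin, nsmul_eq_mul, lap]
        linear_combination c * u x ^ 2 * (2 + a) * h4

lemma rellich_pointwise {n : ℕ} {a C : ℝ} (hC : C = ((n : ℝ) - 2 - a) * (n - 2 + a) / 4)
    (hC0 : 0 ≤ C) {u : Euc n → ℝ} (hu : ContDiff ℝ (⊤ : ℕ∞) u) {x : Euc n} (hx : x ≠ 0) :
    C ^ 2 * (u x ^ 2 * ‖x‖ ^ (-2 - a)) + 2 * C * ∑ i, fderiv ℝ
        (rellichField a (-((n : ℝ) - 2) / 2) u i) x (EuclideanSpace.single i 1) ≤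
      lap u x ^ 2 * ‖x‖ ^ (2 - a) := by
  have hpos : 0 < ‖x‖ := norm_pos_iff.mpr hx
  have h2 : ‖x‖ ^ (2 - a) = ‖x‖ ^ (-2 - a) * ‖x‖ ^ 4 := by
    rw [← Real.rpow_add_natCast hpos.ne']; congr 1; push_cast; ring
  have hcs := Finset.sum_mul_sq_le_sq_mul_sq univ (fun i => x i) (fun i => pd i u x)
  rw [← EuclideanSpace.real_norm_sq_eq x] at hcs
  rw [sum_fderiv_rellichField _ _ hu hx, h2]
  set S := ∑ i, x i * pd i u x
  set G := ∑ i, pd i u x ^ 2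
  set b : ℝ := ((n : ℝ) - 2 - a) / 2 with hb
  have hgrad : 0 ≤ ‖x‖ ^ 2 * G + 2 * b * u x * S + b ^ 2 * u x ^ 2 := by
    nlinarith [sq_nonneg (S + b * u x)]
  have key : 0 ≤ ‖x‖ ^ (-2 - a) * ((lap u x * ‖x‖ ^ 2 + C * u x) ^ 2 +
      2 * C * (‖x‖ ^ 2 * G + 2 * b * u x * S + b ^ 2 * u x ^ 2)) := by positivity
  rw [← sub_nonneg]
  convert key using 1
  rw [hb]
  linear_combination (-2 * C * ‖x‖ ^ (-2 - a) * u x ^ 2) * hC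

theorem stmt9 {n : ℕ} (hn : 3 ≤ n) :
    ∀ μ : ℝ, 0 ≤ μ → μ < 1 →
      ∀ u : Euc n → ℝ, ContDiff ℝ (⊤ : ℕ∞) u → HasCompactSupport u →
        tsupport u ⊆ {x : Euc n | x ≠ 0} →
        (((n : ℝ) - 2) / 2) ^ 4 * (1 - μ ^ 2) ^ 2 *
            ∫ x in {x : Euc n | x ≠ 0}, u x ^ 2 * ‖x‖ ^ (-2 - ((n : ℝ) - 2) * μ)
          ≤ ∫ x in {x : Euc n | x ≠ 0},
              lap u x ^ 2 * ‖x‖ ^ (2 - ((n : ℝ) - 2) * μ) := by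
  intro μ hμ0 hμ1 u hu hcpt hsupp
  set a : ℝ := ((n : ℝ) - 2) * μ with ha
  set C : ℝ := ((n : ℝ) - 2 - a) * (n - 2 + a) / 4 with hC
  have hn' : (3 : ℝ) ≤ n := by exact_mod_cast hn
  have hC0 : 0 ≤ C := by
    have h1 : 0 ≤ (n : ℝ) - 2 - a := by rw [ha]; nlinarith
    have h2 : 0 ≤ (n : ℝ) - 2 + a := by rw [ha]; nlinarith
    positivity
  have hconst : (((n : ℝ) - 2) / 2) ^ 4 * (1 - μ ^ 2) ^ 2 = C ^ 2 := by
    rw [hC, ha]; ring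
  have hu0 (x : Euc n) (hx : x ∉ tsupport u) : u x = 0 := image_eq_zero_of_notMem_tsupport hx
  have hK : IsCompact (tsupport u) := hcpt
  have hI : Integrable (fun x : Euc n => u x ^ 2 * ‖x‖ ^ (-2 - a)) :=
    integrable_of_continuousAt_of_ne_zero hK hsupp (fun x hx => by simp [hu0 x hx]) fun x hx =>
      (hu.continuous.pow 2).continuousAt.mul
        (contDiffAt_norm_rpow (k := 0) _ hx).continuousAt
  have hA : Integrable (fun x : Euc n => lap u x ^ 2 * ‖x‖ ^ (2 - a)) :=
    integrable_of_continuousAt_of_ne_zero hK hsupp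
      (fun x hx => by simp [lap_eq_zero_of_notMem_tsupport hx]) fun x hx =>
      ((continuous_lap hu).pow 2).continuousAt.mul
        (contDiffAt_norm_rpow (k := 0) _ hx).continuousAt
  have hV (i : Fin n) := integrable_fderiv_and_integral_eq_zero hK hsupp
    (f := rellichField a (-((n : ℝ) - 2) / 2) u i)
    (fun x hx => by simp [rellichField, hu0 x hx])
    (fun x hx => contDiffAt_rellichField _ _ hu i hx) (EuclideanSpace.single i 1)
  have hD := integrable_finsetSum univ fun i _ => (hV i).1
  have hD0 : ∫ x : Euc n, ∑ i, fderiv ℝ (rellichField a (-((n : ℝ) - 2) / 2) u i) x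
      (EuclideanSpace.single i 1) = 0 := by
    rw [integral_finsetSum _ fun i _ => (hV i).1]
    exact Finset.sum_eq_zero fun i _ => (hV i).2
  have : Nonempty (Fin n) := ⟨⟨0, by omega⟩⟩
  have hne : ∀ᵐ x : Euc n, x ≠ 0 := Measure.ae_ne volume 0
  have hvol : (volume : Measure (Euc n)).restrict {x | x ≠ 0} = volume :=
    Measure.restrict_eq_self_of_ae_mem hne
  rw [hconst, hvol]
  calc C ^ 2 * ∫ x : Euc n, u x ^ 2 * ‖x‖ ^ (-2 - a)
      = ∫ x : Euc n, (C ^ 2 * (u x ^ 2 * ‖x‖ ^ (-2 - a)) + 2 * C * ∑ i, fderiv ℝ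
        (rellichField a (-((n : ℝ) - 2) / 2) u i) x (EuclideanSpace.single i 1)) := by
        rw [integral_add (hI.const_mul _) (hD.const_mul _), integral_const_mul,
          integral_const_mul, hD0, mul_zero, add_zero]
    _ ≤ _ := by
        refine integral_mono_ae ((hI.const_mul _).add (hD.const_mul _)) hA ?_
        filter_upwards [hne] with x hx
        exact rellich_pointwise hC hC0 hu hx
end
end

section
/- Let 1 < p < ∞, let Ω ⊆ ℝⁿ be open, and let v : Ω → ℝ be twice continuously differentiable and positive on Ω with ∇v(x) ≠ 0 for every x ∈ Ω, satisfying the p-Laplace equation ∑_{i=1}^n ∂ᵢ(|∇v|^{p−2} ∂ᵢv) = 0 pointwise on Ω. Then for every α ∈ (0,1) the function v^α satisfies −∑_{i=1}^n ∂ᵢ(|∇(v^α)|^{p−2} ∂ᵢ(v^α)) = α^{p−1}(1−α)(p−1) |∇v/v|^p · (v^α)^{p−1} pointwise on Ω. -/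
open MeasureTheory Finset

noncomputable section

theorem gradient_apply_eq_pd {n : ℕ} (u : Euc n → ℝ) (x : Euc n) (i : Fin n) :
    gradient u x i = pd i u x := by
  have h : inner ℝ (gradient u x) (EuclideanSpace.single i (1 : ℝ)) = pd i u x := by
    rw [gradient, InnerProductSpace.toDual_symm_apply, pd]
  rw [← h, EuclideanSpace.inner_single_right]
  simp

theorem sum_pd_sq {n : ℕ} (u : Euc n → ℝ) (x : Euc n) :
    ∑ i, pd i u x ^ 2 = ‖gradient u x‖ ^ 2 := by
  rw [EuclideanSpace.norm_sq_eq]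
  simp [gradient_apply_eq_pd]

theorem hasGradientAt_rpow {n : ℕ} {v : Euc n → ℝ} {x : Euc n} (α : ℝ)
    (hv : DifferentiableAt ℝ v x) (hx : 0 < v x) :
    HasGradientAt (fun z => v z ^ α) ((α * v x ^ (α - 1)) • gradient v x) x := by
  have h := hv.hasFDerivAt.rpow_const (p := α) (Or.inl hx.ne')
  rw [hasGradientAt_iff_hasFDerivAt, map_smul]
  simpa [gradient] using h

theorem differentiableAt_flux {n : ℕ} {v : Euc n → ℝ} {x : Euc n} (p : ℝ)
    (hv : ContDiffAt ℝ 2 v x) (hx : gradient v x ≠ 0) (i : Fin n) :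
    DifferentiableAt ℝ (fun y => ‖gradient v y‖ ^ (p - 2) * pd i v y) x := by
  have hd : DifferentiableAt ℝ (fderiv ℝ v) x :=
    (hv.fderiv_right (m := 1) (by norm_num)).differentiableAt (by norm_num)
  have hg : DifferentiableAt ℝ (gradient v) x :=
    (InnerProductSpace.toDual ℝ (Euc n)).symm.differentiableAt.comp x hd
  have hpd : DifferentiableAt ℝ (pd i v) x := hd.clm_apply (differentiableAt_const _)
  exact ((hg.norm ℝ hx).rpow_const (Or.inl (norm_ne_zero_iff.2 hx))).mul hpd

theorem flux_rpow {n : ℕ} {v : Euc n → ℝ} {x : Euc n} {α : ℝ} (p : ℝ) (hα : 0 < α)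
    (hv : DifferentiableAt ℝ v x) (hx : 0 < v x) (i : Fin n) :
    ‖gradient (fun z => v z ^ α) x‖ ^ (p - 2) * pd i (fun z => v z ^ α) x =
      α ^ (p - 1) * v x ^ ((α - 1) * (p - 1)) * (‖gradient v x‖ ^ (p - 2) * pd i v x) := by
  have hc : 0 < α * v x ^ (α - 1) := by positivity
  rw [← gradient_apply_eq_pd, (hasGradientAt_rpow α hv hx).gradient, norm_smul,
    Real.norm_of_nonneg hc.le, Real.mul_rpow hc.le (norm_nonneg _), PiLp.smul_apply,
    gradient_apply_eq_pd, smul_eq_mul]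
  have h : (α * v x ^ (α - 1)) ^ (p - 2) * (α * v x ^ (α - 1)) =
      α ^ (p - 1) * v x ^ ((α - 1) * (p - 1)) := by
    rw [← Real.rpow_add_one hc.ne', show p - 2 + 1 = p - 1 by ring,
      Real.mul_rpow hα.le (by positivity), ← Real.rpow_mul hx.le]
  rw [← h]
  ring

theorem pd_rpow_mul {n : ℕ} {v F : Euc n → ℝ} {x : Euc n} (c β : ℝ)
    (hv : DifferentiableAt ℝ v x) (hx : 0 < v x) (hF : DifferentiableAt ℝ F x) (i : Fin n) :
    pd i (fun y => c * v y ^ β * F y) x =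
      c * v x ^ β * pd i F x + c * β * v x ^ (β - 1) * (pd i v x * F x) := by
  have h := ((hv.hasFDerivAt.rpow_const (p := β) (Or.inl hx.ne')).const_mul c).mul hF.hasFDerivAt
  have h' : fderiv ℝ (fun y => c * v y ^ β * F y) x = _ := h.fderiv
  simp only [pd, h', add_apply, smul_apply, smul_eq_mul]
  ring

theorem stmt10 {n : ℕ} (p : ℝ) (hp : 1 < p) {Ω : Set (Euc n)} (hΩ : IsOpen Ω)
    (v : Euc n → ℝ) (hv : ContDiffOn ℝ 2 v Ω) (hvp : ∀ x ∈ Ω, 0 < v x)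
    (hgrad : ∀ x ∈ Ω, gradient v x ≠ 0)
    (hpLap : ∀ x ∈ Ω,
      ∑ i, pd i (fun y => ‖gradient v y‖ ^ (p - 2) * pd i v y) x = 0) :
    ∀ α : ℝ, α ∈ Set.Ioo (0 : ℝ) 1 → ∀ x ∈ Ω,
      -(∑ i, pd i (fun y => ‖gradient (fun z => v z ^ α) y‖ ^ (p - 2) *
            pd i (fun z => v z ^ α) y) x)
        = α ^ (p - 1) * (1 - α) * (p - 1) * (‖gradient v x‖ / v x) ^ p *
            (v x ^ α) ^ (p - 1) := by
  intro α hα x hx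
  have hvx := hvp x hx
  have hcd : ∀ y ∈ Ω, ContDiffAt ℝ 2 v y := fun y hy => hv.contDiffAt (hΩ.mem_nhds hy)
  have hdiff : ∀ y ∈ Ω, DifferentiableAt ℝ v y :=
    fun y hy => (hcd y hy).differentiableAt (by norm_num)
  have hpd : ∀ i, pd i (fun y => ‖gradient (fun z => v z ^ α) y‖ ^ (p - 2) *
      pd i (fun z => v z ^ α) y) x =
      α ^ (p - 1) * v x ^ ((α - 1) * (p - 1)) *
        pd i (fun y => ‖gradient v y‖ ^ (p - 2) * pd i v y) x +
      α ^ (p - 1) * ((α - 1) * (p - 1)) * v x ^ ((α - 1) * (p - 1) - 1) *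
        ‖gradient v x‖ ^ (p - 2) * pd i v x ^ 2 := by
    intro i
    have he : (fun y => ‖gradient (fun z => v z ^ α) y‖ ^ (p - 2) *
        pd i (fun z => v z ^ α) y) =ᶠ[nhds x]
        fun y => α ^ (p - 1) * v y ^ ((α - 1) * (p - 1)) *
          (‖gradient v y‖ ^ (p - 2) * pd i v y) := by
      filter_upwards [hΩ.mem_nhds hx] with y hy
      exact flux_rpow p hα.1 (hdiff y hy) (hvp y hy) i
    have hpd_congr := congrArg (fun L : Euc n →L[ℝ] ℝ => L (EuclideanSpace.single i 1)) he.fderiv_eq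
    refine hpd_congr.trans ?_
    refine (pd_rpow_mul _ _ (hdiff x hx) hvx
      (differentiableAt_flux p (hcd x hx) (hgrad x hx) i) i).trans ?_
    ring
  have hg : 0 < ‖gradient v x‖ := norm_pos_iff.2 (hgrad x hx)
  have hnorm : ‖gradient v x‖ ^ (p - 2) * ‖gradient v x‖ ^ 2 = ‖gradient v x‖ ^ p := by
    rw [← Real.rpow_natCast, ← Real.rpow_add hg]
    norm_num
  have hpow : v x ^ ((α - 1) * (p - 1) - 1) = (v x ^ p)⁻¹ * (v x ^ α) ^ (p - 1) := by
    rw [← Real.rpow_mul hvx.le, ← Real.rpow_neg hvx.le, ← Real.rpow_add hvx]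
    congr 1
    ring
  rw [Finset.sum_congr rfl fun i _ => hpd i, Finset.sum_add_distrib, ← Finset.mul_sum,
    ← Finset.mul_sum, hpLap x hx, sum_pd_sq, Real.div_rpow hg.le hvx.le, ← hnorm, hpow]
  ring
end
end

section
/- For every φ ∈ C_c^∞(ℝⁿ₊) the improved Hardy inequality ∫_{ℝⁿ₊} |∇φ(x)|² dx ≥ (1/4) ∫_{ℝⁿ₊} (1/x_n² + (n−1)²/|x|²) φ(x)² dx holds. -/
open MeasureTheory

noncomputable section

theorem ContDiff.sq_mul_of_tsupport {E : Type*} [NormedAddCommGroup E] [NormedSpace ℝ E]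
    {φ W : E → ℝ} {k : WithTop ℕ∞} (hφ : ContDiff ℝ k φ)
    (hW : ∀ x ∈ tsupport φ, ContDiffAt ℝ k W x) : ContDiff ℝ k fun x => φ x ^ 2 * W x := by
  refine contDiff_iff_contDiffAt.2 fun x => ?_
  by_cases hx : x ∈ tsupport φ
  · exact (hφ.contDiffAt.pow 2).mul (hW x hx)
  · refine (contDiffAt_const (c := (0 : ℝ))).congr_of_eventuallyEq ?_
    filter_upwards [notMem_tsupport_iff_eventuallyEq.1 hx] with y hy
    simp [hy]

theorem HasCompactSupport.sq_mul {E : Type*} [TopologicalSpace E]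
    {φ : E → ℝ} (hφ : HasCompactSupport φ) (W : E → ℝ) :
    HasCompactSupport fun x => φ x ^ 2 * W x :=
  hφ.mono fun x hx h => hx (by simp [h])

theorem integral_fderiv_apply_eq_zero {E : Type*} [NormedAddCommGroup E] [NormedSpace ℝ E]
    [FiniteDimensional ℝ E] [MeasurableSpace E] [BorelSpace E] (μ : Measure E)
    [μ.IsAddHaarMeasure] {g : E → ℝ} (hg : ContDiff ℝ 1 g) (hc : HasCompactSupport g) (v : E) :
    Integrable (fun x => fderiv ℝ g x v) μ ∧ ∫ x, fderiv ℝ g x v ∂μ = 0 := by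
  have hi : Integrable (fun x => fderiv ℝ g x v) μ :=
    ((hg.continuous_fderiv one_ne_zero).clm_apply continuous_const).integrable_of_hasCompactSupport
      (hc.fderiv_apply ℝ v)
  refine ⟨hi, ?_⟩
  have := integral_mul_fderiv_eq_neg_fderiv_mul_of_integrable (μ := μ) (f := fun _ => (1 : ℝ))
    (g := g) (v := v) (by simp) (by simpa using hi)
    (by simpa using hg.continuous.integrable_of_hasCompactSupport hc)
    (fun _ _ => differentiableAt_const _) (fun x _ => hg.differentiable one_ne_zero x)
  simpa using this

theorem integral_fderiv_self_add_card_mul_eq_zero {n : ℕ} {g : Euc n → ℝ}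
    (hg : ContDiff ℝ 1 g) (hc : HasCompactSupport g) :
    Integrable (fun x => fderiv ℝ g x x + n * g x) ∧
      ∫ x, (fderiv ℝ g x x + n * g x) = 0 := by
  have hcoord (i : Fin n) : ContDiff ℝ 1 fun x : Euc n => x i * g x :=
    (EuclideanSpace.proj (𝕜 := ℝ) i).contDiff.mul hg
  have hi (i : Fin n) := integral_fderiv_apply_eq_zero volume (hcoord i) hc.mul_left
    (EuclideanSpace.single i (1 : ℝ))
  have hsum (x : Euc n) : fderiv ℝ g x x + n * g x =
      ∑ i, fderiv ℝ (fun y : Euc n => y i * g y) x (EuclideanSpace.single i (1 : ℝ)) := by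
    have hd (i : Fin n) : fderiv ℝ (fun y : Euc n => y i * g y) x
        (EuclideanSpace.single i (1 : ℝ)) =
          x i * fderiv ℝ g x (EuclideanSpace.single i (1 : ℝ)) + g x := by
      have h := ((EuclideanSpace.proj (𝕜 := ℝ) i).hasFDerivAt (x := x)).mul
        (hg.differentiable one_ne_zero x).hasFDerivAt
      have h' : HasFDerivAt (fun y : Euc n => y i * g y) _ x := h
      rw [h'.fderiv]
      simp
    have hx : x = ∑ i, x i • EuclideanSpace.single i (1 : ℝ) := by
      simpa using ((EuclideanSpace.basisFun (Fin n) ℝ).sum_repr x).symm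
    simp only [hd, Finset.sum_add_distrib]
    conv_lhs => rw [show fderiv ℝ g x x = fderiv ℝ g x (∑ i, x i • EuclideanSpace.single i 1) from
      congrArg _ hx]
    simp [map_sum]
  simp only [hsum]
  refine ⟨integrable_finsetSum _ fun i _ => (hi i).1, ?_⟩
  rw [integral_finsetSum _ fun i _ => (hi i).1]
  simp [(hi _).2]

theorem fderiv_sq_mul_inv {E : Type*} [NormedAddCommGroup E] [NormedSpace ℝ E]
    {φ W : E → ℝ} {W' : E →L[ℝ] ℝ} {x : E} (hφ : DifferentiableAt ℝ φ x)
    (hW : HasFDerivAt W W' x) (h0 : W x ≠ 0) (v : E) :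
    fderiv ℝ (fun y => φ y ^ 2 * (W y)⁻¹) x v =
      2 * φ x * fderiv ℝ φ x v / W x - φ x ^ 2 * W' v / W x ^ 2 := by
  have h := (hφ.hasFDerivAt.pow 2).mul ((hasDerivAt_inv h0).comp_hasFDerivAt x hW)
  have h' : HasFDerivAt (fun y => φ y ^ 2 * (W y)⁻¹) _ x := h
  rw [h'.fderiv]
  simp
  field_simp
  ring

theorem hardy_pointwise {E : Type*} [NormedAddCommGroup E] [InnerProductSpace ℝ E]
    (d e x : E) (p m : ℝ) (he : ‖e‖ = 1) (ht : 0 < inner ℝ x e) :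
    1 / 4 * ((1 / inner ℝ x e ^ 2 + (m - 1) ^ 2 / ‖x‖ ^ 2) * p ^ 2) +
        1 / 2 * (2 * p * inner ℝ d e / inner ℝ x e - p ^ 2 * 1 / inner ℝ x e ^ 2) -
        (m - 1) / 2 * (2 * p * inner ℝ d x / ‖x‖ ^ 2 -
          p ^ 2 * (2 * ‖x‖ ^ 2) / (‖x‖ ^ 2) ^ 2 + m * (p ^ 2 * (‖x‖ ^ 2)⁻¹)) ≤ ‖d‖ ^ 2 := by
  have hx : ‖x‖ ≠ 0 := fun h => by simp [norm_eq_zero.1 h] at ht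
  have key := sq_nonneg ‖d - (p / (2 * inner ℝ x e)) • e + (p * (m - 1) / (2 * ‖x‖ ^ 2)) • x‖
  rw [norm_add_sq_real, norm_sub_sq_real, norm_smul, norm_smul, inner_sub_left,
    real_inner_smul_right, real_inner_smul_right, real_inner_smul_right, real_inner_smul_left,
    real_inner_comm x e, he, mul_pow, mul_pow, Real.norm_eq_abs, Real.norm_eq_abs, sq_abs,
    sq_abs] at key
  rw [← sub_nonneg]
  refine key.trans_eq ?_
  field_simp
  ring

theorem stmt12 {n : ℕ} (hn : 2 ≤ n)
    (φ : Euc n → ℝ) (hφ : ContDiff ℝ (⊤ : ℕ∞) φ) (hcs : HasCompactSupport φ)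
    (hsupp : tsupport φ ⊆ {x : Euc n | 0 < x ⟨n - 1, by omega⟩}) :
    (1 / 4 : ℝ) *
        ∫ x in {x : Euc n | 0 < x ⟨n - 1, by omega⟩},
          (1 / (x ⟨n - 1, by omega⟩) ^ 2 + ((n : ℝ) - 1) ^ 2 / ‖x‖ ^ 2) * φ x ^ 2
      ≤ ∫ x in {x : Euc n | 0 < x ⟨n - 1, by omega⟩}, ‖gradient φ x‖ ^ 2 := by
  generalize_proofs hlt at *
  set N : Fin n := ⟨n - 1, hlt⟩
  set e : Euc n := EuclideanSpace.single N 1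
  have hxe (x : Euc n) : inner ℝ x e = x N := by simp [e, EuclideanSpace.inner_single_right]
  have h1 : ContDiff ℝ 1 φ := hφ.of_le (by exact_mod_cast le_top)
  have hpos {x : Euc n} (hx : x ∈ tsupport φ) : 0 < x N := hsupp hx
  have hR {x : Euc n} (hx : 0 < x N) : ‖x‖ ^ 2 ≠ 0 :=
    pow_ne_zero 2 fun h => by simp [norm_eq_zero.1 h] at hx
  have hcoord : ContDiff ℝ 1 fun x : Euc n => x N := (EuclideanSpace.proj (𝕜 := ℝ) N).contDiff
  have hnorm : ContDiff ℝ 1 fun x : Euc n => ‖x‖ ^ 2 := contDiff_norm_sq ℝ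
  have hV := h1.sq_mul_of_tsupport
    (W := fun x : Euc n => 1 / x N ^ 2 + ((n : ℝ) - 1) ^ 2 / ‖x‖ ^ 2) fun x hx =>
      (contDiffAt_const.div (hcoord.contDiffAt.pow 2) (pow_ne_zero 2 (hpos hx).ne')).add
        (contDiffAt_const.div hnorm.contDiffAt (hR (hpos hx)))
  have hVi := hV.continuous.integrable_of_hasCompactSupport (μ := volume) (hcs.sq_mul _)
  obtain ⟨hi₁, hz₁⟩ := integral_fderiv_apply_eq_zero volume
    (h1.sq_mul_of_tsupport (W := fun x : Euc n => (x N)⁻¹) fun x hx =>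
      hcoord.contDiffAt.inv (hpos hx).ne') (hcs.sq_mul _) e
  obtain ⟨hi₂, hz₂⟩ := integral_fderiv_self_add_card_mul_eq_zero
    (h1.sq_mul_of_tsupport (W := fun x : Euc n => (‖x‖ ^ 2)⁻¹) fun x hx =>
      hnorm.contDiffAt.inv (hR (hpos hx))) (hcs.sq_mul _)
  have hgrad (x : Euc n) : ‖gradient φ x‖ = ‖fderiv ℝ φ x‖ := by
    simp [gradient]
  have hgi : Integrable (fun x => ‖gradient φ x‖ ^ 2) (volume : Measure (Euc n)) := by
    simp only [hgrad]
    refine ((h1.continuous_fderiv one_ne_zero).norm.pow 2).integrable_of_hasCompactSupport ?_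
    exact (hcs.fderiv ℝ).mono fun x hx h => hx (by simp [h])
  simp only [mul_comm (φ _ ^ 2)] at hVi
  rw [setIntegral_eq_integral_of_forall_compl_eq_zero,
    setIntegral_eq_integral_of_forall_compl_eq_zero]
  rotate_left
  · intro x hx
    simp [hgrad, fderiv_of_notMem_tsupport ℝ fun h => hx (hsupp h)]
  · intro x hx
    simp [image_eq_zero_of_notMem_tsupport fun h => hx (hsupp h)]
  have hle := integral_mono (((hVi.const_mul (1 / 4)).add (hi₁.const_mul (1 / 2))).sub
    (hi₂.const_mul (((n : ℝ) - 1) / 2))) hgi fun x => ?_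
  · rw [integral_sub' ((hVi.const_mul (1 / 4)).add (hi₁.const_mul (1 / 2)))
      (hi₂.const_mul (((n : ℝ) - 1) / 2)), integral_add' (hVi.const_mul (1 / 4))
      (hi₁.const_mul (1 / 2)), integral_const_mul, integral_const_mul, integral_const_mul,
      hz₁, hz₂] at hle
    simpa using hle
  · simp only [Pi.sub_apply, Pi.add_apply]
    by_cases hx : x ∈ tsupport φ
    · have hd := h1.differentiable one_ne_zero x
      have hN : HasFDerivAt (fun y : Euc n => y N) (EuclideanSpace.proj (𝕜 := ℝ) N) x :=
        (EuclideanSpace.proj (𝕜 := ℝ) N).hasFDerivAt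
      rw [fderiv_sq_mul_inv hd hN (hpos hx).ne',
        fderiv_sq_mul_inv hd (hasStrictFDerivAt_norm_sq x).hasFDerivAt (hR (hpos hx))]
      have := hardy_pointwise (gradient φ x) e x (φ x) n (by simp [e])
        (by rw [hxe]; exact hpos hx)
      have hin (v : Euc n) : inner ℝ (gradient φ x) v = fderiv ℝ φ x v := by
        rw [← toDual_gradient]; rfl
      simp only [hin, hxe] at this
      simpa [e] using this
    · have h0 (W : Euc n → ℝ) : fderiv ℝ (fun y => φ y ^ 2 * W y) x = 0 :=
        fderiv_of_notMem_tsupport ℝ fun h => hx <|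
          closure_mono (fun y (hy : φ y ^ 2 * W y ≠ 0) (h : φ y = 0) => hy (by simp [h])) h
      simp [h0, image_eq_zero_of_notMem_tsupport hx]
end
end

section
/- Let 0 ≤ μ ≤ 1/4, set α₊ := (1 + √(1−4μ))/2 and β := 1 − n − √(1−4μ). Then the function ψ(x) := x_n^{α₊} |x|^{β/2} satisfies Δψ(x) + (μ/x_n² + β²/(4|x|²)) ψ(x) = 0 for every x ∈ ℝⁿ₊; that is, ψ is a positive solution of the equation (−Δ − μ/x_n² − β²/(4|x|²)) u = 0 in ℝⁿ₊. -/
open MeasureTheory Finset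

noncomputable section

/-- The function `y ↦ y_k ^ p * (|y|²) ^ r`. -/
def coordNormPow {n : ℕ} (k : Fin n) (p r : ℝ) (y : Euc n) : ℝ :=
  (y k) ^ p * (‖y‖ ^ 2) ^ r

lemma norm_sq_pos_of_coord_pos {n : ℕ} {k : Fin n} {y : Euc n} (hy : 0 < y k) :
    0 < ‖y‖ ^ 2 := by
  have : y ≠ 0 := by
    rintro rfl
    simp at hy
  positivity

lemma hasFDerivAt_coord {n : ℕ} (k : Fin n) (y : Euc n) :
    HasFDerivAt (fun z : Euc n => z k) (EuclideanSpace.proj k : Euc n →L[ℝ] ℝ) y :=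
  (EuclideanSpace.proj k : Euc n →L[ℝ] ℝ).hasFDerivAt

lemma hasFDerivAt_coordNormPow {n : ℕ} (k : Fin n) (p r : ℝ) {y : Euc n} (hy : 0 < y k) :
    HasFDerivAt (coordNormPow k p r)
      ((y k) ^ p • ((r * (‖y‖ ^ 2) ^ (r - 1)) • (2 • innerSL ℝ y)) +
        (‖y‖ ^ 2) ^ r • ((p * (y k) ^ (p - 1)) • (EuclideanSpace.proj k : Euc n →L[ℝ] ℝ))) y :=
  ((hasFDerivAt_coord k y).rpow_const (Or.inl hy.ne')).mul
    ((hasStrictFDerivAt_norm_sq y).hasFDerivAt.rpow_const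
      (Or.inl (norm_sq_pos_of_coord_pos hy).ne'))

lemma fderiv_coordNormPow_single {n : ℕ} (k i : Fin n) (p r : ℝ) {y : Euc n} (hy : 0 < y k) :
    fderiv ℝ (coordNormPow k p r) y (EuclideanSpace.single i 1) =
      (p * if k = i then 1 else 0) * coordNormPow k (p - 1) r y +
        2 * r * (y i * coordNormPow k p (r - 1) y) := by
  rw [(hasFDerivAt_coordNormPow k p r hy).fderiv]
  simp [coordNormPow, EuclideanSpace.inner_single_right]
  ring_nf

lemma pd2_coordNormPow {n : ℕ} (k i : Fin n) (p r : ℝ) {x : Euc n} (hx : 0 < x k) :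
    pd2 i i (coordNormPow k p r) x =
      (if k = i then p * (p - 1) * coordNormPow k (p - 2) r x +
          4 * p * r * x k * coordNormPow k (p - 1) (r - 1) x else 0) +
        2 * r * coordNormPow k p (r - 1) x +
        4 * r * (r - 1) * coordNormPow k p (r - 2) x * x i ^ 2 := by
  have hpos : ∀ᶠ y : Euc n in nhds x, 0 < y k :=
    (hasFDerivAt_coord k x).continuousAt.eventually (lt_mem_nhds hx)
  have hfirst : (fun y => fderiv ℝ (coordNormPow k p r) y (EuclideanSpace.single i 1)) =ᶠ[nhds x]
      fun y => (p * if k = i then 1 else 0) * coordNormPow k (p - 1) r y +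
        2 * r * (y i * coordNormPow k p (r - 1) y) := by
    filter_upwards [hpos] with y hy using fderiv_coordNormPow_single k i p r hy
  have hd (p r : ℝ) : HasFDerivAt (coordNormPow k p r) (fderiv ℝ (coordNormPow k p r) x) x :=
    (hasFDerivAt_coordNormPow k p r hx).differentiableAt.hasFDerivAt
  have hsecond := ((hd (p - 1) r).const_mul (p * if k = i then 1 else 0)).add
    (((hasFDerivAt_coord i x).mul (hd p (r - 1))).const_mul (2 * r))
  rw [pd2, hfirst.fderiv_eq]
  erw [hsecond.fderiv]
  have hp : p - 1 - 1 = p - 2 := by ring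
  have hr : r - 1 - 1 = r - 2 := by ring
  simp only [add_apply, smul_apply, smul_eq_mul,
    fderiv_coordNormPow_single k i _ _ hx, PiLp.proj_apply, PiLp.single_apply, hp, hr]
  by_cases hki : k = i
  · subst hki
    simp
    ring
  · simp [hki]
    ring

lemma lap_coordNormPow {n : ℕ} (k : Fin n) (p r : ℝ) {x : Euc n} (hx : 0 < x k) :
    lap (coordNormPow k p r) x =
      (p * (p - 1) / x k ^ 2 + 2 * r * (2 * p + n + 2 * (r - 1)) / ‖x‖ ^ 2) *
        coordNormPow k p r x := by
  have hq := norm_sq_pos_of_coord_pos hx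
  simp only [lap, pd2_coordNormPow k _ p r hx, sum_add_distrib, ← mul_sum,
    ← EuclideanSpace.real_norm_sq_eq, sum_ite_eq, mem_univ, if_true, sum_const, card_univ,
    Fintype.card_fin, nsmul_eq_mul]
  simp only [coordNormPow, Real.rpow_sub_one hx.ne', Real.rpow_sub_one hq.ne',
    Real.rpow_sub hx, Real.rpow_sub hq, Real.rpow_two]
  field_simp
  ring

theorem stmt13 {n : ℕ} (hn : 2 ≤ n) (μ : ℝ) (hμ0 : 0 ≤ μ) (hμ : μ ≤ 1 / 4)
    (a β : ℝ) (ha : a = (1 + Real.sqrt (1 - 4 * μ)) / 2)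
    (hβ : β = 1 - (n : ℝ) - Real.sqrt (1 - 4 * μ))
    (ψ : Euc n → ℝ)
    (hψ : ∀ x : Euc n, ψ x = (x ⟨n - 1, by omega⟩) ^ a * ‖x‖ ^ (β / 2)) :
    ∀ x : Euc n, 0 < x ⟨n - 1, by omega⟩ →
      0 < ψ x ∧
      lap ψ x + (μ / (x ⟨n - 1, by omega⟩) ^ 2 + β ^ 2 / (4 * ‖x‖ ^ 2)) * ψ x
        = 0 := by
  intro x hx
  have hs := Real.sq_sqrt (show 0 ≤ 1 - 4 * μ by linarith)
  have hψ' : ψ = coordNormPow ⟨n - 1, by omega⟩ a (β / 4) := by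
    funext y
    rw [hψ, coordNormPow, ← Real.rpow_natCast, ← Real.rpow_mul (norm_nonneg y)]
    congr 2
    push_cast
    ring
  have hq := norm_sq_pos_of_coord_pos hx
  constructor
  · rw [hψ', coordNormPow]
    positivity
  · have hμa : μ = -(a * (a - 1)) := by
      rw [ha]
      linarith
    have hn' : (n : ℝ) = 2 - 2 * a - β := by
      rw [ha, hβ]
      ring
    rw [hψ', lap_coordNormPow _ _ _ hx, hn', hμa]
    field_simp
    ring
end
end
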